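/- arXiv:2301.06728 — 7 statements merged into one kernel-verified Lean document; each statement's English description precedes it below -/
import Mathlib

section
/- Let w be a regular linear functional on ℂ[z] with monic OPS (P_n)_{n≥0}, and suppose w satisfies the distributional Pearson equation 𝐃_q(φ·w) = 𝐒_q(ψ·w), where φ(z) = az² + bz + c and ψ(z) = dz + e with d ≠ 0. Set d_n = aγ_n + dα_n and e_n = bγ_n + eα_n (with the conventions γ_{−1} = −1 and α_{−1} = α), and assume d_n ≠ 0 for all n ≥ −1. Then (P_n) satisfies the three-term recurrence P_{n+1}(z) = (z − B_n)P_n(z) − C_n P_{n−1}(z) with B_0 = −e_0/d_0, B_n = γ_n e_{n−1}/d_{2n−2} − γ_{n+1} e_n/d_{2n} for n ≥ 1, and C_{n+1} = −(γ_{n+1} d_{n−1}/(d_{2n−1} d_{2n+1}))·φ^{[n]}(−e_n/d_{2n}) for n ≥ 0, where φ^{[n]}(z) = (d(α²−1)γ_{2n} + aα_{2n})(z² − 1/2) + (bα_n + e(α²−1)γ_n)z + c + a/2. -/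
open Polynomial

noncomputable section

/-- `q^{1/2}` as a complex number, for a real `q`. -/
def qh (q : ℝ) : ℂ := ((Real.sqrt q : ℝ) : ℂ)

/-- `α = (q^{1/2} + q^{-1/2})/2`. -/
def alp (q : ℝ) : ℂ := (qh q + (qh q)⁻¹) / 2

/-- `α_n = (q^{n/2} + q^{-n/2})/2` (so that `α_{-1} = α`). -/
def alpn (q : ℝ) (n : ℤ) : ℂ := ((qh q) ^ n + (qh q) ^ (-n)) / 2

/-- `γ_n = (q^{n/2} - q^{-n/2})/(q^{1/2} - q^{-1/2})` (so that `γ_{-1} = -1`). -/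
def gamn (q : ℝ) (n : ℤ) : ℂ := ((qh q) ^ n - (qh q) ^ (-n)) / (qh q - (qh q)⁻¹)

/-- `U₂(z) = (α² - 1)(z² - 1)` as a polynomial. -/
def U2 (q : ℝ) : ℂ[X] := Polynomial.C ((alp q) ^ 2 - 1) * (X ^ 2 - 1)

/-- Defining property of the Askey–Wilson operator `𝒟_q` on `ℂ[z]`:
for every `w ≠ 0` with `w² ≠ 1`,
`(𝒟_q p)((w+w⁻¹)/2) = [p((q^{1/2}w+q^{-1/2}w⁻¹)/2) − p((q^{-1/2}w+q^{1/2}w⁻¹)/2)]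
  / (((q^{1/2}−q^{-1/2})/2)(w−w⁻¹))`. -/
def IsAW (q : ℝ) (D : ℂ[X] → ℂ[X]) : Prop :=
  ∀ p : ℂ[X], ∀ w : ℂ, w ≠ 0 → w ^ 2 ≠ 1 →
    (D p).eval ((w + w⁻¹) / 2) =
      (p.eval ((qh q * w + (qh q)⁻¹ * w⁻¹) / 2) -
          p.eval (((qh q)⁻¹ * w + qh q * w⁻¹) / 2)) /
        (((qh q - (qh q)⁻¹) / 2) * (w - w⁻¹))

/-- Defining property of the averaging operator `𝒮_q` on `ℂ[z]`:
for every `w ≠ 0` with `w² ≠ 1`,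
`(𝒮_q p)((w+w⁻¹)/2) = (1/2)[p((q^{1/2}w+q^{-1/2}w⁻¹)/2) + p((q^{-1/2}w+q^{1/2}w⁻¹)/2)]`. -/
def IsAv (q : ℝ) (S : ℂ[X] → ℂ[X]) : Prop :=
  ∀ p : ℂ[X], ∀ w : ℂ, w ≠ 0 → w ^ 2 ≠ 1 →
    (S p).eval ((w + w⁻¹) / 2) =
      (p.eval ((qh q * w + (qh q)⁻¹ * w⁻¹) / 2) +
          p.eval (((qh q)⁻¹ * w + qh q * w⁻¹) / 2)) / 2

/-- A monic orthogonal polynomial sequence with recurrence coefficients `(B_n, C_n)`: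
monic polynomials, `deg P_n = n`, `P_0 = 1` and the three-term recurrence
`P_{n+1} = (z - B_n) P_n - C_n P_{n-1}` (with `P_{-1} = 0`), `C_n ≠ 0` for `n ≥ 1`. -/
structure MonicOPS (P : ℕ → ℂ[X]) (B Co : ℕ → ℂ) : Prop where
  monic : ∀ n, (P n).Monic
  deg : ∀ n, (P n).natDegree = n
  p0 : P 0 = 1
  p1 : P 1 = X - Polynomial.C (B 0)
  ttrr : ∀ n : ℕ,
    P (n + 2) = (X - Polynomial.C (B (n + 1))) * P (n + 1) - Polynomial.C (Co (n + 1)) * P n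
  Cne : ∀ n : ℕ, 1 ≤ n → Co n ≠ 0

/-- The Appell-type property `𝒮_q(𝒟_q P_n) = k_n P_{n-1}` for all `n ≥ 0` (with `P_{-1} = 0`). -/
def AppellSD (Sq Dq : ℂ[X] → ℂ[X]) (P : ℕ → ℂ[X]) (k : ℕ → ℂ) : Prop :=
  Sq (Dq (P 0)) = 0 ∧ ∀ n : ℕ, Sq (Dq (P (n + 1))) = Polynomial.C (k (n + 1)) * P n

/-- The Appell-type property `𝒟_q(𝒮_q P_n) = k_n P_{n-1}` for all `n ≥ 0` (with `P_{-1} = 0`). -/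
def AppellDS (Dq Sq : ℂ[X] → ℂ[X]) (P : ℕ → ℂ[X]) (k : ℕ → ℂ) : Prop :=
  Dq (Sq (P 0)) = 0 ∧ ∀ n : ℕ, Dq (Sq (P (n + 1))) = Polynomial.C (k (n + 1)) * P n

end

noncomputable section

/-- `d_n = a γ_n + d α_n`. -/
def dcoef (q : ℝ) (a d : ℂ) (n : ℤ) : ℂ := a * gamn q n + d * alpn q n

/-- `e_n = b γ_n + e α_n`. -/
def ecoef (q : ℝ) (b e : ℂ) (n : ℤ) : ℂ := b * gamn q n + e * alpn q n

/-- `φ^{[n]}(z) = (d(α²−1)γ_{2n} + aα_{2n})(z² − 1/2) + (bα_n + e(α²−1)γ_n)z + c + a/2`. -/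
def phin (q : ℝ) (a b c d e : ℂ) (n : ℤ) (z : ℂ) : ℂ :=
  (d * ((alp q) ^ 2 - 1) * gamn q (2 * n) + a * alpn q (2 * n)) * (z ^ 2 - 1 / 2) +
    (b * alpn q n + e * ((alp q) ^ 2 - 1) * gamn q n) * z + c + a / 2

end

/-! ### Basic facts on `q^{1/2}` and the coefficients -/

lemma qh_ne {q : ℝ} (hq0 : 0 < q) : qh q ≠ 0 := by
  unfold qh
  exact_mod_cast (Real.sqrt_pos.mpr hq0).ne'

lemma qh_sq_ne {q : ℝ} (hq0 : 0 < q) (hq1 : q < 1) : qh q ^ 2 - 1 ≠ 0 := by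
  unfold qh
  intro h
  have h1 : (Real.sqrt q) ^ 2 - 1 = 0 := by exact_mod_cast h
  rw [Real.sq_sqrt hq0.le] at h1
  linarith

lemma qh_sub_ne {q : ℝ} (hq0 : 0 < q) (hq1 : q < 1) : qh q - (qh q)⁻¹ ≠ 0 := by
  have h := qh_sq_ne hq0 hq1
  have h0 := qh_ne hq0
  intro h1
  apply h
  field_simp at h1
  simpa using h1

lemma alp_ne {q : ℝ} (hq0 : 0 < q) : alp q ≠ 0 := by
  unfold alp qh
  have h := Real.sqrt_pos.mpr hq0
  have h2 : (Real.sqrt q + (Real.sqrt q)⁻¹) / 2 ≠ 0 := by positivity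
  exact_mod_cast h2

/-- polynomial version of `γ`. -/
noncomputable def gam0 (s x : ℂ) : ℂ := (x - x⁻¹) / (s - s⁻¹)

noncomputable def alp0 (x : ℂ) : ℂ := (x + x⁻¹) / 2

lemma gamn_eq (q : ℝ) (n : ℤ) : gamn q n = gam0 (qh q) (qh q ^ n) := by
  unfold gamn gam0; rw [zpow_neg]

lemma alpn_eq (q : ℝ) (n : ℤ) : alpn q n = alp0 (qh q ^ n) := by
  unfold alpn alp0; rw [zpow_neg]

/-- second coefficient of `𝒟_q z^n`. -/
noncomputable def ucf (q : ℝ) (n : ℤ) : ℂ := (n * gamn q (n - 2) - (n - 2) * gamn q n) / 4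

/-- second coefficient of `𝒮_q z^n`. -/
noncomputable def vcf (q : ℝ) (n : ℤ) : ℂ := n * (alpn q (n - 2) - alpn q n) / 4

section ids
variable {q : ℝ} (hq0 : 0 < q) (hq1 : q < 1)

lemma gam_succ (hq0 : 0 < q) (hq1 : q < 1) (n : ℤ) :
    gamn q (n + 1) = alpn q n + alp q * gamn q n := by
  have h0 := qh_ne hq0
  have h1 := qh_sq_ne hq0 hq1
  have h2 := qh_sub_ne hq0 hq1
  have hx : qh q ^ n ≠ 0 := zpow_ne_zero _ h0
  rw [gamn_eq, gamn_eq, alpn_eq, zpow_add₀ h0, zpow_one]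
  unfold gam0 alp0 alp
  generalize qh q ^ n = x at *
  generalize qh q = s at *
  field_simp
  ring

lemma alp_succ (hq0 : 0 < q) (hq1 : q < 1) (n : ℤ) :
    alpn q (n + 1) = alp q * alpn q n + (alp q ^ 2 - 1) * gamn q n := by
  have h0 := qh_ne hq0
  have h1 := qh_sq_ne hq0 hq1
  have h2 := qh_sub_ne hq0 hq1
  have hx : qh q ^ n ≠ 0 := zpow_ne_zero _ h0
  rw [gamn_eq, alpn_eq, alpn_eq, zpow_add₀ h0, zpow_one]
  unfold gam0 alp0 alp
  generalize qh q ^ n = x at *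
  generalize qh q = s at *
  field_simp
  ring

lemma gam_pred (hq0 : 0 < q) (hq1 : q < 1) (n : ℤ) :
    gamn q (n - 1) = alp q * gamn q n - alpn q n := by
  have h1 := gam_succ hq0 hq1 (n - 1)
  have h2 := alp_succ hq0 hq1 (n - 1)
  rw [sub_add_cancel] at h1 h2
  rw [h1, h2]; ring

lemma alp_pred (hq0 : 0 < q) (hq1 : q < 1) (n : ℤ) :
    alpn q (n - 1) = alp q * alpn q n - (alp q ^ 2 - 1) * gamn q n := by
  have h1 := gam_succ hq0 hq1 (n - 1)
  have h2 := alp_succ hq0 hq1 (n - 1)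
  rw [sub_add_cancel] at h1 h2
  rw [h1, h2]; ring

lemma gam_two (hq0 : 0 < q) (n : ℤ) :
    gamn q (2 * n) = 2 * alpn q n * gamn q n := by
  have h0 := qh_ne hq0
  have hx : qh q ^ n ≠ 0 := zpow_ne_zero _ h0
  rw [gamn_eq, gamn_eq, alpn_eq, two_mul, zpow_add₀ h0]
  unfold gam0 alp0
  generalize qh q ^ n = x at *
  generalize qh q - (qh q)⁻¹ = s at *
  field_simp
  ring

lemma alp_two (hq0 : 0 < q) (n : ℤ) :
    alpn q (2 * n) = 2 * alpn q n ^ 2 - 1 := by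
  have h0 := qh_ne hq0
  have hx : qh q ^ n ≠ 0 := zpow_ne_zero _ h0
  rw [alpn_eq, alpn_eq, two_mul, zpow_add₀ h0]
  unfold alp0
  generalize qh q ^ n = x at *
  field_simp
  ring

lemma alp_gam_rel (hq0 : 0 < q) (hq1 : q < 1) (n : ℤ) :
    alpn q n ^ 2 = 1 + (alp q ^ 2 - 1) * gamn q n ^ 2 := by
  have h0 := qh_ne hq0
  have h1 := qh_sq_ne hq0 hq1
  have h2 := qh_sub_ne hq0 hq1
  have hx : qh q ^ n ≠ 0 := zpow_ne_zero _ h0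
  rw [gamn_eq, alpn_eq]
  unfold gam0 alp0 alp
  generalize qh q ^ n = x at *
  generalize qh q = s at *
  field_simp
  ring

lemma gam_zero : gamn q 0 = 0 := by simp [gamn]

lemma alp_zero : alpn q 0 = 1 := by simp [alpn]

end ids

section ids2
variable {q : ℝ}

lemma gam_pred2 (hq0 : 0 < q) (hq1 : q < 1) (n : ℤ) :
    gamn q (n - 2) = alp q * (alp q * gamn q n - alpn q n) -
      (alp q * alpn q n - (alp q ^ 2 - 1) * gamn q n) := by
  rw [show n - 2 = n - 1 - 1 by ring, gam_pred hq0 hq1, gam_pred hq0 hq1, alp_pred hq0 hq1]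

lemma alp_pred2 (hq0 : 0 < q) (hq1 : q < 1) (n : ℤ) :
    alpn q (n - 2) = alp q * (alp q * alpn q n - (alp q ^ 2 - 1) * gamn q n) -
      (alp q ^ 2 - 1) * (alp q * gamn q n - alpn q n) := by
  rw [show n - 2 = n - 1 - 1 by ring, alp_pred hq0 hq1, gam_pred hq0 hq1, alp_pred hq0 hq1]

lemma ucf_succ (hq0 : 0 < q) (hq1 : q < 1) (n : ℤ) :
    ucf q (n + 1) = vcf q n + alp q * ucf q n := by
  unfold ucf vcf
  rw [show n + 1 - 2 = n - 1 by ring, gam_pred2 hq0 hq1, alp_pred2 hq0 hq1, gam_pred hq0 hq1,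
    gam_succ hq0 hq1]
  push_cast
  ring

lemma vcf_succ (hq0 : 0 < q) (hq1 : q < 1) (n : ℤ) :
    vcf q (n + 1) = (alp q ^ 2 - 1) * (ucf q n - gamn q n) + alp q * vcf q n := by
  unfold ucf vcf
  rw [show n + 1 - 2 = n - 1 by ring, gam_pred2 hq0 hq1, alp_pred2 hq0 hq1, alp_pred hq0 hq1,
    alp_succ hq0 hq1]
  push_cast
  ring

end ids2

/-! ### Coefficients indexed by integers -/

/-- coefficient of `z^k`, `k : ℤ`. -/
noncomputable def cz (k : ℤ) : ℂ[X] →ₗ[ℂ] ℂ := if 0 ≤ k then Polynomial.lcoeff ℂ k.toNat else 0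

lemma cz_nat (k : ℕ) (p : ℂ[X]) : cz k p = p.coeff k := by
  simp [cz]

lemma cz_neg (k : ℤ) (hk : k < 0) (p : ℂ[X]) : cz k p = 0 := by
  simp [cz, not_le.mpr hk]

lemma cz_X_mul (k : ℤ) (p : ℂ[X]) : cz k (X * p) = cz (k - 1) p := by
  rcases lt_trichotomy k 0 with h | h | h
  · rw [cz_neg _ h, cz_neg _ (by omega)]
  · subst h
    rw [cz_neg (0 - 1) (by omega)]
    have := cz_nat 0 (X * p)
    simpa using this
  · obtain ⟨m, rfl⟩ : ∃ m : ℕ, k = (m + 1 : ℕ) := ⟨(k - 1).toNat, by omega⟩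
    rw [cz_nat, show ((m + 1 : ℕ) : ℤ) - 1 = (m : ℕ) by push_cast; ring, cz_nat]
    simp

lemma cz_C_mul (k : ℤ) (a : ℂ) (p : ℂ[X]) : cz k (Polynomial.C a * p) = a * cz k p := by
  rw [← Polynomial.smul_eq_C_mul, map_smul, smul_eq_mul]

lemma cz_X_pow (k : ℤ) (n : ℕ) : cz k (X ^ n : ℂ[X]) = if k = n then 1 else 0 := by
  by_cases hk : k < 0
  · rw [cz_neg _ hk, if_neg (by omega)]
  · obtain ⟨m, rfl⟩ : ∃ m : ℕ, k = m := ⟨k.toNat, by omega⟩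
    rw [cz_nat, Polynomial.coeff_X_pow]
    norm_cast

lemma lin_ext (l1 l2 : ℂ[X] →ₗ[ℂ] ℂ) (N : ℤ) (p : ℂ[X])
    (h : ∀ j : ℕ, (j : ℤ) ≤ N → l1 (X ^ j) = l2 (X ^ j))
    (hp : ∀ j : ℤ, N < j → cz j p = 0) : l1 p = l2 p := by
  rw [p.as_sum_support_C_mul_X_pow, map_sum, map_sum]
  refine Finset.sum_congr rfl fun j hj => ?_
  rw [← Polynomial.smul_eq_C_mul, map_smul, map_smul]
  by_cases hjN : (j : ℤ) ≤ N
  · rw [h j hjN]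
  · have := hp j (by omega)
    rw [cz_nat] at this
    rw [this]; simp

/-! ### Uniqueness of polynomials in `(w+1/w)/2` -/

lemma ext_w (p r : ℂ[X]) (M : ℝ) (hM : 1 < M)
    (h : ∀ t : ℝ, M < t → p.eval (((t : ℂ) + (t : ℂ)⁻¹) / 2) = r.eval (((t : ℂ) + (t : ℂ)⁻¹) / 2)) :
    p = r := by
  apply Polynomial.eq_of_infinite_eval_eq
  have hinj : Set.InjOn (fun t : ℝ => ((t : ℂ) + (t : ℂ)⁻¹) / 2) (Set.Ioi M) := by
    intro t ht t' ht' htt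
    have ht : M < t := ht
    have ht' : M < t' := ht'
    have h1 : (t + t⁻¹) / 2 = (t' + t'⁻¹) / 2 := by
      have : ((t : ℂ) + (t : ℂ)⁻¹) / 2 = ((t' : ℂ) + (t' : ℂ)⁻¹) / 2 := htt
      exact_mod_cast this
    have p1 : 0 < t := by linarith
    have p2 : 0 < t' := by linarith
    field_simp at h1
    have h2 : (t - t') * (t * t' - 1) = 0 := by linarith
    rcases mul_eq_zero.mp h2 with h3 | h3
    · linarith
    · nlinarith
  refine Set.Infinite.mono ?_ ((Set.Ioi_infinite M).image hinj)
  rintro _ ⟨t, ht, rfl⟩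
  exact h t ht

/-! ### Properties of the operators -/

section ops
variable {q : ℝ} {Dq Sq : ℂ[X] → ℂ[X]}

lemma real_w {t : ℝ} (ht : 1 < t) : (t : ℂ) ≠ 0 ∧ (t : ℂ) ^ 2 ≠ 1 := by
  constructor
  · exact_mod_cast (by linarith : t ≠ 0)
  · have : t ^ 2 ≠ 1 := by nlinarith
    exact_mod_cast this

lemma w_sub_ne {w : ℂ} (h0 : w ≠ 0) (h1 : w ^ 2 ≠ 1) : w - w⁻¹ ≠ 0 := by
  intro h
  field_simp at h
  exact h1 (sub_eq_zero.mp (by simpa using h))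

lemma D_add (hD : IsAW q Dq) (f g : ℂ[X]) : Dq (f + g) = Dq f + Dq g := by
  refine ext_w _ _ 2 (by norm_num) fun t ht => ?_
  obtain ⟨h0, h1⟩ := real_w (by linarith : 1 < t)
  rw [Polynomial.eval_add, hD _ _ h0 h1, hD _ _ h0 h1, hD _ _ h0 h1]
  simp only [Polynomial.eval_add]
  ring

lemma D_smul (hD : IsAW q Dq) (a : ℂ) (f : ℂ[X]) : Dq (a • f) = a • Dq f := by
  refine ext_w _ _ 2 (by norm_num) fun t ht => ?_
  obtain ⟨h0, h1⟩ := real_w (by linarith : 1 < t)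
  rw [Polynomial.eval_smul, hD _ _ h0 h1, hD _ _ h0 h1]
  simp only [Polynomial.eval_smul, smul_eq_mul]
  ring

lemma S_add (hS : IsAv q Sq) (f g : ℂ[X]) : Sq (f + g) = Sq f + Sq g := by
  refine ext_w _ _ 2 (by norm_num) fun t ht => ?_
  obtain ⟨h0, h1⟩ := real_w (by linarith : 1 < t)
  rw [Polynomial.eval_add, hS _ _ h0 h1, hS _ _ h0 h1, hS _ _ h0 h1]
  simp only [Polynomial.eval_add]
  ring

lemma S_smul (hS : IsAv q Sq) (a : ℂ) (f : ℂ[X]) : Sq (a • f) = a • Sq f := by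
  refine ext_w _ _ 2 (by norm_num) fun t ht => ?_
  obtain ⟨h0, h1⟩ := real_w (by linarith : 1 < t)
  rw [Polynomial.eval_smul, hS _ _ h0 h1, hS _ _ h0 h1]
  simp only [Polynomial.eval_smul, smul_eq_mul]
  ring

lemma D_one (hD : IsAW q Dq) : Dq 1 = 0 := by
  refine ext_w _ _ 2 (by norm_num) fun t ht => ?_
  obtain ⟨h0, h1⟩ := real_w (by linarith : 1 < t)
  rw [hD _ _ h0 h1]
  simp

lemma S_one (hS : IsAv q Sq) : Sq 1 = 1 := by
  refine ext_w _ _ 2 (by norm_num) fun t ht => ?_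
  obtain ⟨h0, h1⟩ := real_w (by linarith : 1 < t)
  rw [hS _ _ h0 h1]
  simp

lemma D_X_mul (hq0 : 0 < q) (hq1 : q < 1) (hD : IsAW q Dq) (hS : IsAv q Sq) (f : ℂ[X]) :
    Dq (X * f) = Sq f + Polynomial.C (alp q) * (X * Dq f) := by
  refine ext_w _ _ 2 (by norm_num) fun t ht => ?_
  obtain ⟨h0, h1⟩ := real_w (by linarith : 1 < t)
  have h2 := w_sub_ne h0 h1
  have h3 := qh_sub_ne hq0 hq1
  simp only [Polynomial.eval_add, Polynomial.eval_mul, Polynomial.eval_C, Polynomial.eval_X]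
  rw [hD _ _ h0 h1, hD _ _ h0 h1, hS _ _ h0 h1]
  simp only [Polynomial.eval_mul, Polynomial.eval_X]
  unfold alp
  generalize Polynomial.eval _ f = A
  generalize Polynomial.eval _ f = A'
  generalize (t : ℂ)⁻¹ = w' at *
  generalize (t : ℂ) = w at *
  generalize (qh q)⁻¹ = s' at *
  generalize qh q = s at *
  field_simp
  ring

lemma S_X_mul (hq0 : 0 < q) (hq1 : q < 1) (hD : IsAW q Dq) (hS : IsAv q Sq) (f : ℂ[X]) :
    Sq (X * f) = Polynomial.C (alp q ^ 2 - 1) * (X * (X * Dq f)) -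
      Polynomial.C (alp q ^ 2 - 1) * Dq f + Polynomial.C (alp q) * (X * Sq f) := by
  refine ext_w _ _ 2 (by norm_num) fun t ht => ?_
  obtain ⟨h0, h1⟩ := real_w (by linarith : 1 < t)
  have h2 := w_sub_ne h0 h1
  have h3 := qh_sub_ne hq0 hq1
  have hs := qh_ne hq0
  have e1 : alp q ^ 2 - 1 = ((qh q - (qh q)⁻¹) / 2) ^ 2 := by
    unfold alp; field_simp; ring
  have e2 : (((t : ℂ) + (t : ℂ)⁻¹) / 2) ^ 2 - 1 = (((t : ℂ) - (t : ℂ)⁻¹) / 2) ^ 2 := by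
    field_simp; ring
  rw [e1]
  simp only [Polynomial.eval_add, Polynomial.eval_sub, Polynomial.eval_mul, Polynomial.eval_C,
    Polynomial.eval_X]
  rw [hD _ _ h0 h1, hS _ _ h0 h1, hS _ _ h0 h1]
  simp only [Polynomial.eval_mul, Polynomial.eval_X]
  unfold alp
  generalize Polynomial.eval _ f = A
  generalize Polynomial.eval _ f = A'
  have e3 : ∀ K Y : ℂ, K * (((t : ℂ) + (t : ℂ)⁻¹) / 2 * (((t : ℂ) + (t : ℂ)⁻¹) / 2 * Y)) - K * Y
      = K * (((t : ℂ) - (t : ℂ)⁻¹) / 2) ^ 2 * Y := by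
    intro K Y; rw [← e2]; ring
  rw [e3]
  generalize (t : ℂ)⁻¹ = w' at *
  generalize (t : ℂ) = w at *
  generalize (qh q)⁻¹ = s' at *
  generalize qh q = s at *
  field_simp
  ring

lemma D_cas (hq0 : 0 < q) (hq1 : q < 1) (hD : IsAW q Dq) (hS : IsAv q Sq) (f g : ℂ[X]) :
    Dq (Dq f * Sq g - Sq f * Dq g) = g * Dq (Dq f) - f * Dq (Dq g) ∧
    Sq (Dq f * Sq g - Sq f * Dq g) = g * Sq (Dq f) - f * Sq (Dq g) := by
  set r : ℝ := Real.sqrt q with hr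
  have hr0 : 0 < r := Real.sqrt_pos.mpr hq0
  have hr1 : r < 1 := by
    rw [hr, Real.sqrt_lt' one_pos]; simpa using hq1
  have hri : 1 < r⁻¹ := (one_lt_inv₀ hr0).mpr hr1
  have hs := qh_ne hq0
  have h3 := qh_sub_ne hq0 hq1
  -- value of the Casoratian
  have key : ∀ w : ℂ, w ≠ 0 → w ^ 2 ≠ 1 → (Dq f * Sq g - Sq f * Dq g).eval ((w + w⁻¹) / 2) =
      (f.eval ((qh q * w + (qh q)⁻¹ * w⁻¹) / 2) * g.eval (((qh q)⁻¹ * w + qh q * w⁻¹) / 2) -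
       f.eval (((qh q)⁻¹ * w + qh q * w⁻¹) / 2) * g.eval ((qh q * w + (qh q)⁻¹ * w⁻¹) / 2)) /
        (((qh q - (qh q)⁻¹) / 2) * (w - w⁻¹)) := by
    intro w h0 h1
    simp only [Polynomial.eval_sub, Polynomial.eval_mul]
    rw [hD _ _ h0 h1, hD _ _ h0 h1, hS _ _ h0 h1, hS _ _ h0 h1]
    ring
  -- shifted points
  have shift : ∀ t : ℝ, r⁻¹ < t → ((t : ℂ) ≠ 0 ∧ (t : ℂ) ^ 2 ≠ 1) ∧
      (qh q * t ≠ 0 ∧ (qh q * t) ^ 2 ≠ 1) ∧ ((qh q)⁻¹ * t ≠ 0 ∧ ((qh q)⁻¹ * t) ^ 2 ≠ 1) := by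
    intro t ht
    have a1 : 1 < t := by linarith
    have a2 : 1 < r * t := by
      have := mul_lt_mul_of_pos_left ht hr0
      rwa [mul_inv_cancel₀ hr0.ne'] at this
    have a3 : 1 < r⁻¹ * t := by nlinarith
    have b2 := real_w a2
    have b3 := real_w a3
    push_cast at b2 b3
    exact ⟨real_w a1, b2, b3⟩
  have plus : ∀ (k : ℂ[X]) (t : ℝ), r⁻¹ < t →
      (Dq k).eval ((qh q * t + (qh q)⁻¹ * (t : ℂ)⁻¹) / 2) =
      (k.eval ((qh q * (qh q * t) + (qh q)⁻¹ * ((qh q)⁻¹ * (t : ℂ)⁻¹)) / 2) -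
        k.eval (((t : ℂ) + (t : ℂ)⁻¹) / 2)) /
        (((qh q - (qh q)⁻¹) / 2) * (qh q * t - (qh q)⁻¹ * (t : ℂ)⁻¹)) := by
    intro k t ht
    obtain ⟨_, ⟨h0, h1⟩, _⟩ := shift t ht
    have := hD k _ h0 h1
    rw [mul_inv] at this
    rw [this, inv_mul_cancel_left₀ hs, mul_inv_cancel_left₀ hs]
  have minus : ∀ (k : ℂ[X]) (t : ℝ), r⁻¹ < t →
      (Dq k).eval (((qh q)⁻¹ * t + qh q * (t : ℂ)⁻¹) / 2) =
      (k.eval (((t : ℂ) + (t : ℂ)⁻¹) / 2) -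
        k.eval (((qh q)⁻¹ * ((qh q)⁻¹ * t) + qh q * (qh q * (t : ℂ)⁻¹)) / 2)) /
        (((qh q - (qh q)⁻¹) / 2) * ((qh q)⁻¹ * t - qh q * (t : ℂ)⁻¹)) := by
    intro k t ht
    obtain ⟨_, _, ⟨h0, h1⟩⟩ := shift t ht
    have := hD k _ h0 h1
    rw [mul_inv, inv_inv] at this
    rw [this, inv_mul_cancel_left₀ hs, mul_inv_cancel_left₀ hs]
  have Hplus : ∀ t : ℝ, r⁻¹ < t →
      (Dq f * Sq g - Sq f * Dq g).eval ((qh q * t + (qh q)⁻¹ * (t : ℂ)⁻¹) / 2) =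
      g.eval (((t : ℂ) + (t : ℂ)⁻¹) / 2) * (Dq f).eval ((qh q * t + (qh q)⁻¹ * (t : ℂ)⁻¹) / 2) -
      f.eval (((t : ℂ) + (t : ℂ)⁻¹) / 2) * (Dq g).eval ((qh q * t + (qh q)⁻¹ * (t : ℂ)⁻¹) / 2) := by
    intro t ht
    obtain ⟨_, ⟨h0, h1⟩, _⟩ := shift t ht
    have := key _ h0 h1
    rw [mul_inv, inv_mul_cancel_left₀ hs, mul_inv_cancel_left₀ hs] at this
    rw [this, plus f t ht, plus g t ht]
    ring
  have Hminus : ∀ t : ℝ, r⁻¹ < t →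
      (Dq f * Sq g - Sq f * Dq g).eval (((qh q)⁻¹ * t + qh q * (t : ℂ)⁻¹) / 2) =
      g.eval (((t : ℂ) + (t : ℂ)⁻¹) / 2) * (Dq f).eval (((qh q)⁻¹ * t + qh q * (t : ℂ)⁻¹) / 2) -
      f.eval (((t : ℂ) + (t : ℂ)⁻¹) / 2) * (Dq g).eval (((qh q)⁻¹ * t + qh q * (t : ℂ)⁻¹) / 2) := by
    intro t ht
    obtain ⟨_, _, ⟨h0, h1⟩⟩ := shift t ht
    have := key _ h0 h1
    rw [mul_inv, inv_inv, inv_mul_cancel_left₀ hs, mul_inv_cancel_left₀ hs] at this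
    rw [this, minus f t ht, minus g t ht]
    ring
  constructor
  · refine ext_w _ _ r⁻¹ hri fun t ht => ?_
    obtain ⟨⟨h0, h1⟩, _, _⟩ := shift t ht
    rw [hD _ _ h0 h1, Hplus t ht, Hminus t ht, Polynomial.eval_sub, Polynomial.eval_mul,
      Polynomial.eval_mul, hD _ _ h0 h1, hD _ _ h0 h1]
    ring
  · refine ext_w _ _ r⁻¹ hri fun t ht => ?_
    obtain ⟨⟨h0, h1⟩, _, _⟩ := shift t ht
    rw [hS _ _ h0 h1, Hplus t ht, Hminus t ht, Polynomial.eval_sub, Polynomial.eval_mul,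
      Polynomial.eval_mul, hS _ _ h0 h1, hS _ _ h0 h1]
    ring

/-- `𝒟_q` as a linear map. -/
noncomputable def DL (hD : IsAW q Dq) : ℂ[X] →ₗ[ℂ] ℂ[X] where
  toFun := Dq
  map_add' := D_add hD
  map_smul' := D_smul hD

/-- `𝒮_q` as a linear map. -/
noncomputable def SL (hS : IsAv q Sq) : ℂ[X] →ₗ[ℂ] ℂ[X] where
  toFun := Sq
  map_add' := S_add hS
  map_smul' := S_smul hS

lemma monom (hq0 : 0 < q) (hq1 : q < 1) (hD : IsAW q Dq) (hS : IsAv q Sq) (n : ℕ) :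
    (∀ k : ℤ, (n : ℤ) - 3 ≤ k → cz k (Dq (X ^ n)) =
      (if k = n - 1 then gamn q n else 0) + (if k = n - 3 then ucf q n else 0)) ∧
    (∀ k : ℤ, (n : ℤ) - 2 ≤ k → cz k (Sq (X ^ n)) =
      (if k = n then alpn q n else 0) + (if k = n - 2 then vcf q n else 0)) := by
  induction n with
  | zero =>
    rw [pow_zero, D_one hD, S_one hS]
    constructor
    · intro k _
      simp [gam_zero, ucf]
    · intro k _
      have := cz_X_pow k 0
      rw [pow_zero] at this
      rw [this]
      simp [alp_zero, vcf]
  | succ n ih =>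
    obtain ⟨ihD, ihS⟩ := ih
    constructor
    · intro k hk
      push_cast at hk ⊢
      rw [pow_succ', D_X_mul hq0 hq1 hD hS, map_add, cz_C_mul, cz_X_mul, ihS k (by omega),
        ihD (k - 1) (by omega), gam_succ hq0 hq1, ucf_succ hq0 hq1]
      split_ifs <;> first | omega | ring
    · intro k hk
      push_cast at hk ⊢
      rw [pow_succ', S_X_mul hq0 hq1 hD hS, map_add, map_sub, cz_C_mul, cz_C_mul, cz_C_mul,
        cz_X_mul, cz_X_mul, cz_X_mul, ihS (k - 1) (by omega),
        ihD (k - 1 - 1) (by omega), ihD k (by omega), alp_succ hq0 hq1, vcf_succ hq0 hq1]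
      split_ifs <;> first | omega | ring

lemma cz_D (hq0 : 0 < q) (hq1 : q < 1) (hD : IsAW q Dq) (hS : IsAv q Sq) (p : ℂ[X]) (k : ℤ)
    (hp : ∀ j : ℤ, k + 3 < j → cz j p = 0) :
    cz k (Dq p) = gamn q (k + 1) * cz (k + 1) p + ucf q (k + 3) * cz (k + 3) p := by
  have := lin_ext ((cz k).comp (DL hD)) (gamn q (k + 1) • cz (k + 1) + ucf q (k + 3) • cz (k + 3))
    (k + 3) p ?_ hp
  · simpa [DL] using this
  · intro j hj
    have h := (monom hq0 hq1 hD hS j).1 k (by omega)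
    simp only [LinearMap.comp_apply, LinearMap.add_apply, LinearMap.smul_apply, smul_eq_mul,
      cz_X_pow]
    change cz k (Dq (X ^ j)) = _
    rw [h]
    by_cases h1 : (j : ℤ) = k + 1
    · rw [h1]; simp; omega
    · by_cases h2 : (j : ℤ) = k + 3
      · rw [h2]; simp; omega
      · rw [if_neg (by omega), if_neg (by omega), if_neg (by omega), if_neg (by omega)]; simp

lemma cz_S (hq0 : 0 < q) (hq1 : q < 1) (hD : IsAW q Dq) (hS : IsAv q Sq) (p : ℂ[X]) (k : ℤ)
    (hp : ∀ j : ℤ, k + 2 < j → cz j p = 0) :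
    cz k (Sq p) = alpn q k * cz k p + vcf q (k + 2) * cz (k + 2) p := by
  have := lin_ext ((cz k).comp (SL hS)) (alpn q k • cz k + vcf q (k + 2) • cz (k + 2))
    (k + 2) p ?_ hp
  · simpa [SL] using this
  · intro j hj
    have h := (monom hq0 hq1 hD hS j).2 k (by omega)
    simp only [LinearMap.comp_apply, LinearMap.add_apply, LinearMap.smul_apply, smul_eq_mul,
      cz_X_pow]
    change cz k (Sq (X ^ j)) = _
    rw [h]
    by_cases h1 : (j : ℤ) = k
    · rw [h1]; simp; omega
    · by_cases h2 : (j : ℤ) = k + 2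
      · rw [h2]; simp
      · rw [if_neg (by omega), if_neg (by omega), if_neg (by omega), if_neg (by omega)]; simp

end ops

/-- `p` has degree at most `n` with the three given top coefficients. -/
structure HasTop (p : ℂ[X]) (n : ℤ) (A F G : ℂ) : Prop where
  hi : ∀ k : ℤ, n < k → cz k p = 0
  c0 : cz n p = A
  c1 : cz (n - 1) p = F
  c2 : cz (n - 2) p = G

section ops2
variable {q : ℝ} {Dq Sq : ℂ[X] → ℂ[X]}

lemma HasTop.D (hq0 : 0 < q) (hq1 : q < 1) (hD : IsAW q Dq) (hS : IsAv q Sq) {p : ℂ[X]} {n : ℤ}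
    {A F G : ℂ} (h : HasTop p n A F G) :
    HasTop (Dq p) (n - 1) (gamn q n * A) (gamn q (n - 1) * F)
      (gamn q (n - 2) * G + ucf q n * A) := by
  constructor
  · intro k hk
    rw [cz_D hq0 hq1 hD hS p k (fun j hj => h.hi j (by omega)), h.hi (k + 1) (by omega),
      h.hi (k + 3) (by omega)]
    ring
  · rw [cz_D hq0 hq1 hD hS p _ (fun j hj => h.hi j (by omega)), h.hi (n - 1 + 3) (by omega),
      sub_add_cancel, h.c0]
    ring
  · rw [cz_D hq0 hq1 hD hS p _ (fun j hj => h.hi j (by omega)), h.hi (n - 1 - 1 + 3) (by omega),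
      sub_add_cancel, h.c1]
    ring
  · rw [cz_D hq0 hq1 hD hS p _ (fun j hj => h.hi j (by omega)),
      show n - 1 - 2 + 1 = n - 2 by ring, show n - 1 - 2 + 3 = n by ring, h.c0, h.c2]

lemma HasTop.S (hq0 : 0 < q) (hq1 : q < 1) (hD : IsAW q Dq) (hS : IsAv q Sq) {p : ℂ[X]} {n : ℤ}
    {A F G : ℂ} (h : HasTop p n A F G) :
    HasTop (Sq p) n (alpn q n * A) (alpn q (n - 1) * F)
      (alpn q (n - 2) * G + vcf q n * A) := by
  constructor
  · intro k hk
    rw [cz_S hq0 hq1 hD hS p k (fun j hj => h.hi j (by omega)), h.hi k (by omega),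
      h.hi (k + 2) (by omega)]
    ring
  · rw [cz_S hq0 hq1 hD hS p _ (fun j hj => h.hi j (by omega)), h.hi (n + 2) (by omega), h.c0]
    ring
  · rw [cz_S hq0 hq1 hD hS p _ (fun j hj => h.hi j (by omega)), h.hi (n - 1 + 2) (by omega), h.c1]
    ring
  · rw [cz_S hq0 hq1 hD hS p _ (fun j hj => h.hi j (by omega)), sub_add_cancel, h.c0, h.c2]

/-- the second order operator `φ 𝒟² + ψ 𝒮 𝒟`. -/
noncomputable def Lop (Dq Sq : ℂ[X] → ℂ[X]) (a b c d e : ℂ) (f : ℂ[X]) : ℂ[X] :=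
  (Polynomial.C a * X ^ 2 + Polynomial.C b * X + Polynomial.C c) * Dq (Dq f) +
    (Polynomial.C d * X + Polynomial.C e) * Sq (Dq f)

lemma cz_Lop (a b c d e : ℂ) (f : ℂ[X]) (k : ℤ) : cz k (Lop Dq Sq a b c d e f) =
    a * cz (k - 2) (Dq (Dq f)) + b * cz (k - 1) (Dq (Dq f)) + c * cz k (Dq (Dq f)) +
      d * cz (k - 1) (Sq (Dq f)) + e * cz k (Sq (Dq f)) := by
  have : Lop Dq Sq a b c d e f = Polynomial.C a * (X * (X * Dq (Dq f))) +
      Polynomial.C b * (X * Dq (Dq f)) + Polynomial.C c * Dq (Dq f) +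
      Polynomial.C d * (X * Sq (Dq f)) + Polynomial.C e * Sq (Dq f) := by
    unfold Lop; ring
  rw [this]
  simp only [map_add, cz_C_mul, cz_X_mul]
  rw [show k - 1 - 1 = k - 2 by ring]

lemma HasTop.L (hq0 : 0 < q) (hq1 : q < 1) (hD : IsAW q Dq) (hS : IsAv q Sq) {p : ℂ[X]} {n : ℤ}
    {A F G : ℂ} (h : HasTop p n A F G) (a b c d e : ℂ) :
    HasTop (Lop Dq Sq a b c d e p) n
      (gamn q n * dcoef q a d (n - 1) * A)
      (gamn q (n - 1) * dcoef q a d (n - 2) * F + gamn q n * ecoef q b e (n - 1) * A)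
      (gamn q (n - 2) * dcoef q a d (n - 3) * G + gamn q (n - 1) * ecoef q b e (n - 2) * F +
        (c * gamn q n * gamn q (n - 1) +
         a * (gamn q (n - 3) * ucf q n + ucf q (n - 1) * gamn q n) +
         d * (alpn q (n - 3) * ucf q n + vcf q (n - 1) * gamn q n)) * A) := by
  have h1 := h.D hq0 hq1 hD hS
  have h2 := h1.D hq0 hq1 hD hS
  have h3 := h1.S hq0 hq1 hD hS
  have z2 := h2.c0
  have z3 := h2.c1
  have z4 := h2.c2
  have y2 := h3.c0
  have y3 := h3.c1
  have y4 := h3.c2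
  rw [show n - 1 - 1 = n - 2 by ring] at *
  rw [show n - 2 - 1 = n - 3 by ring] at *
  rw [show n - 1 - 2 = n - 3 by ring] at *
  rw [show n - 2 - 2 = n - 4 by ring] at *
  unfold dcoef ecoef
  constructor
  · intro k hk
    rw [cz_Lop, h2.hi _ (by omega), h2.hi _ (by omega), h2.hi _ (by omega), h3.hi _ (by omega),
      h3.hi _ (by omega)]
    ring
  · rw [cz_Lop, h2.hi (n - 1) (by omega), h2.hi n (by omega), h3.hi n (by omega), z2, y2]
    ring
  · rw [cz_Lop, h2.hi (n - 1) (by omega), show n - 1 - 2 = n - 3 by ring,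
      show n - 1 - 1 = n - 2 by ring, z2, z3, y2, y3]
    ring
  · rw [cz_Lop, show n - 2 - 2 = n - 4 by ring,
      show n - 2 - 1 = n - 3 by ring, z2, z3, z4, y3, y4]
    ring

lemma L_symm (hq0 : 0 < q) (hq1 : q < 1) (hD : IsAW q Dq) (hS : IsAv q Sq)
    (u : ℂ[X] →ₗ[ℂ] ℂ) (a b c d e : ℂ)
    (hpearson : ∀ f : ℂ[X],
      -(u ((Polynomial.C a * X ^ 2 + Polynomial.C b * X + Polynomial.C c) * Dq f)) =
        u ((Polynomial.C d * X + Polynomial.C e) * Sq f)) (f g : ℂ[X]) :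
    u (g * Lop Dq Sq a b c d e f) = u (f * Lop Dq Sq a b c d e g) := by
  have h := hpearson (Dq f * Sq g - Sq f * Dq g)
  obtain ⟨h1, h2⟩ := D_cas hq0 hq1 hD hS f g
  rw [h1, h2] at h
  rw [← sub_eq_zero, ← map_sub]
  rw [neg_eq_iff_add_eq_zero, ← map_add] at h
  have e1 : g * Lop Dq Sq a b c d e f - f * Lop Dq Sq a b c d e g =
      (Polynomial.C a * X ^ 2 + Polynomial.C b * X + Polynomial.C c) *
        (g * Dq (Dq f) - f * Dq (Dq g)) +
      (Polynomial.C d * X + Polynomial.C e) * (g * Sq (Dq f) - f * Sq (Dq g)) := by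
    unfold Lop
    ring
  rw [e1]
  exact h

end ops2

section ortho
variable {u : ℂ[X] →ₗ[ℂ] ℂ} {P : ℕ → ℂ[X]} {B Co : ℕ → ℂ}

lemma P_top (hops : MonicOPS P B Co) (n : ℕ) :
    HasTop (P n) n 1 (cz ((n : ℤ) - 1) (P n)) (cz ((n : ℤ) - 2) (P n)) := by
  refine ⟨?_, ?_, rfl, rfl⟩
  · intro k hk
    obtain ⟨m, rfl⟩ : ∃ m : ℕ, k = m := ⟨k.toNat, by omega⟩
    rw [cz_nat]
    apply Polynomial.coeff_eq_zero_of_natDegree_lt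
    rw [hops.deg]; omega
  · rw [cz_nat]
    have := hops.monic n
    rw [Polynomial.Monic, Polynomial.leadingCoeff, hops.deg] at this
    exact this

lemma strip (hops : MonicOPS P B Co) (r : ℂ[X]) (m : ℕ)
    (hr : ∀ k : ℤ, (m : ℤ) + 1 ≤ k → cz k r = 0) :
    ∀ k : ℤ, (m : ℤ) ≤ k → cz k (r - cz m r • P m) = 0 := by
  intro k hk
  have hP := P_top hops m
  rw [map_sub, map_smul, smul_eq_mul]
  rcases hk.eq_or_lt with h | h
  · rw [← h, hP.c0]; ring
  · rw [hr k (by omega), hP.hi k h]; ring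

lemma eq_zero_of_cz (r : ℂ[X]) (hr : ∀ k : ℤ, 0 ≤ k → cz k r = 0) : r = 0 := by
  ext k
  rw [← cz_nat, hr k (by omega)]; simp

lemma orth_low (hops : MonicOPS P B Co) (horth : ∀ m n : ℕ, m ≠ n → u (P m * P n) = 0)
    (n m : ℕ) (hm : m ≤ n) : ∀ r : ℂ[X], (∀ k : ℤ, (m : ℤ) ≤ k → cz k r = 0) →
      u (P n * r) = 0 := by
  induction m with
  | zero =>
    intro r hr
    rw [eq_zero_of_cz r (by simpa using hr)]; simp
  | succ m ih =>
    intro r hr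
    have h1 := ih (by omega) _ (strip hops r m (by push_cast at hr; exact hr))
    rw [mul_sub, map_sub, mul_smul_comm, map_smul, horth n m (by omega)] at h1
    simpa using h1

lemma zero_of_orth (hops : MonicOPS P B Co) (horth : ∀ m n : ℕ, m ≠ n → u (P m * P n) = 0)
    (hreg : ∀ n : ℕ, u (P n ^ 2) ≠ 0) (r : ℂ[X]) (m : ℕ) (hr : ∀ k : ℤ, (m : ℤ) ≤ k → cz k r = 0)
    (h : ∀ j : ℕ, j < m → u (P j * r) = 0) : r = 0 := by
  induction m with
  | zero => exact eq_zero_of_cz r (by simpa using hr)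
  | succ m ih =>
    have h1 := strip hops r m (by push_cast at hr; exact hr)
    have h2 := orth_low hops horth m m le_rfl _ h1
    rw [mul_sub, map_sub, mul_smul_comm, map_smul, h m (by omega), ← pow_two] at h2
    have h3 : cz m r = 0 := by
      have h4 : cz m r * u (P m ^ 2) = 0 := by simpa using h2
      exact (mul_eq_zero.mp h4).resolve_right (hreg m)
    rw [h3, zero_smul, sub_zero] at h1
    exact ih h1 fun j hj => h j (by omega)

lemma eigen {q : ℝ} {Dq Sq : ℂ[X] → ℂ[X]} (hq0 : 0 < q) (hq1 : q < 1) (hD : IsAW q Dq)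
    (hS : IsAv q Sq) (hops : MonicOPS P B Co)
    (horth : ∀ m n : ℕ, m ≠ n → u (P m * P n) = 0)
    (hreg : ∀ n : ℕ, u (P n ^ 2) ≠ 0) (a b c d e : ℂ)
    (hpearson : ∀ f : ℂ[X],
      -(u ((Polynomial.C a * X ^ 2 + Polynomial.C b * X + Polynomial.C c) * Dq f)) =
        u ((Polynomial.C d * X + Polynomial.C e) * Sq f)) (n : ℕ) :
    Lop Dq Sq a b c d e (P n) = (gamn q n * dcoef q a d ((n : ℤ) - 1)) • P n := by
  have hP := P_top hops n
  have hL := hP.L hq0 hq1 hD hS a b c d e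
  rw [← sub_eq_zero]
  apply zero_of_orth hops horth hreg _ n
  · intro k hk
    rw [map_sub, map_smul, smul_eq_mul]
    rcases hk.eq_or_lt with h | h
    · rw [← h, hL.c0, hP.c0]; ring
    · rw [hL.hi k h, hP.hi k h]; ring
  · intro j hj
    rw [mul_sub, map_sub, mul_smul_comm, map_smul, horth j n (by omega),
      L_symm hq0 hq1 hD hS u a b c d e hpearson]
    have hLj := (P_top hops j).L hq0 hq1 hD hS a b c d e
    rw [orth_low hops horth n n le_rfl _ fun k hk => hLj.hi k (by omega)]
    simp

lemma F_eq {q : ℝ} (hq0 : 0 < q) (hq1 : q < 1) (a d : ℂ) (n : ℤ) :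
    gamn q n * dcoef q a d (n - 1) - gamn q (n - 1) * dcoef q a d (n - 2) =
      dcoef q a d (2 * n - 2) := by
  have h := alp_gam_rel hq0 hq1 n
  have h1 : gamn q (2 * n - 2) = gamn q (2 * (n - 1)) := by ring_nf
  have h2 : alpn q (2 * n - 2) = alpn q (2 * (n - 1)) := by ring_nf
  unfold dcoef
  rw [h1, h2, gam_two hq0, alp_two hq0]
  simp only [gam_pred2 hq0 hq1, alp_pred2 hq0 hq1, gam_pred hq0 hq1, alp_pred hq0 hq1]
  grind

lemma G_eq {q : ℝ} (hq0 : 0 < q) (hq1 : q < 1) (a d : ℂ) (n : ℤ) :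
    gamn q n * dcoef q a d (n - 1) - gamn q (n - 2) * dcoef q a d (n - 3) =
      2 * alp q * dcoef q a d (2 * n - 3) := by
  have h := alp_gam_rel hq0 hq1 n
  have h1 : 2 * n - 3 = 2 * (n - 1) - 1 := by ring
  have h3 : n - 3 = n - 2 - 1 := by ring
  unfold dcoef
  rw [h1, h3]
  simp only [gam_pred hq0 hq1, alp_pred hq0 hq1, gam_pred2 hq0 hq1, alp_pred2 hq0 hq1,
    gam_two hq0, alp_two hq0]
  grind

end ortho
/-- the part of the `z^{n-2}` coefficient of `L z^n`. -/
noncomputable def Rcf (q : ℝ) (a c d : ℂ) (n : ℤ) : ℂ :=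
  c * gamn q n * gamn q (n - 1) +
         a * (gamn q (n - 3) * ucf q n + ucf q (n - 1) * gamn q n) +
         d * (alpn q (n - 3) * ucf q n + vcf q (n - 1) * gamn q n)

lemma d_sum {q : ℝ} (hq0 : 0 < q) (hq1 : q < 1) (a d : ℂ) (n : ℤ) :
    dcoef q a d n + dcoef q a d (n + 2) = 2 * alp q * dcoef q a d (n + 1) := by
  unfold dcoef
  rw [show n + 2 = n + 1 + 1 by ring]
  simp only [gam_succ hq0 hq1, alp_succ hq0 hq1]
  ring

lemma final_alg {q : ℝ} (hq0 : 0 < q) (hq1 : q < 1) (a b c d e y : ℂ) (n : ℤ)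
    (hy : ecoef q b e n = y * dcoef q a d (2 * n)) :
    (Rcf q a c d (n + 1) + gamn q n * ecoef q b e (n - 1) * (gamn q (n + 1) * y)) *
        dcoef q a d (2 * n + 1) - Rcf q a c d (n + 2) * dcoef q a d (2 * n - 1) +
      gamn q (n + 1) * y * (gamn q (n + 2) * ecoef q b e (n + 1)) * dcoef q a d (2 * n - 1) -
      2 * alp q * dcoef q a d (2 * n - 1) * dcoef q a d (2 * n + 1) * (gamn q (n + 1) * y) ^ 2 =
    -2 * alp q * gamn q (n + 1) * dcoef q a d (n - 1) * phin q a b c d e n (-y) := by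
  have hr := alp_gam_rel hq0 hq1 n
  have key : (Rcf q a c d (n + 1) + gamn q n * ecoef q b e (n - 1) * (gamn q (n + 1) * y)) *
        dcoef q a d (2 * n + 1) - Rcf q a c d (n + 2) * dcoef q a d (2 * n - 1) +
      gamn q (n + 1) * y * (gamn q (n + 2) * ecoef q b e (n + 1)) * dcoef q a d (2 * n - 1) -
      2 * alp q * dcoef q a d (2 * n - 1) * dcoef q a d (2 * n + 1) * (gamn q (n + 1) * y) ^ 2 +
     2 * alp q * gamn q (n + 1) * dcoef q a d (n - 1) * phin q a b c d e n (-y) =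
     2 * alp q * gamn q (n + 1) * (dcoef q a d (2 * n) * gamn q (n + 1) - a * alpn q (n - 1) -
      d * (alp q ^ 2 - 1) * gamn q (n - 1)) * y * (ecoef q b e n - y * dcoef q a d (2 * n)) := by
    unfold Rcf ucf vcf phin dcoef ecoef
    rw [show n + 2 - 2 = n by ring, show n + 2 - 3 = n - 1 by ring, show n + 2 - 1 - 2 = n - 1 by ring,
      show n + 2 - 1 = n + 1 by ring,
      show n + 1 - 3 = n - 2 by ring, show n + 1 - 1 = n by ring, show n + 1 - 2 = n - 1 by ring,
      show n + 2 = n + 1 + 1 by ring]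
    push_cast
    simp only [gam_pred hq0 hq1, alp_pred hq0 hq1, gam_pred2 hq0 hq1, alp_pred2 hq0 hq1,
      gam_succ hq0 hq1, alp_succ hq0 hq1, gam_two hq0, alp_two hq0]
    generalize gamn q n = g at *
    generalize alpn q n = A at *
    generalize alp q = al at *
    generalize (n : ℂ) = N at *
    grind
  rw [hy] at key
  linear_combination key

/-- if the regular -/
theorem stmt_1 (q : ℝ) (hq0 : 0 < q) (hq1 : q < 1)
    (Dq Sq : ℂ[X] → ℂ[X]) (hD : IsAW q Dq) (hS : IsAv q Sq)
    (u : ℂ[X] →ₗ[ℂ] ℂ) (P : ℕ → ℂ[X]) (B Co : ℕ → ℂ)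
    (hops : MonicOPS P B Co)
    (horth : ∀ m n : ℕ, m ≠ n → u (P m * P n) = 0)
    (hreg : ∀ n : ℕ, u (P n ^ 2) ≠ 0)
    (a b c d e : ℂ) (hd : d ≠ 0)
    (hpearson : ∀ f : ℂ[X],
      -(u ((Polynomial.C a * X ^ 2 + Polynomial.C b * X + Polynomial.C c) * Dq f)) =
        u ((Polynomial.C d * X + Polynomial.C e) * Sq f))
    (hdn : ∀ n : ℤ, -1 ≤ n → dcoef q a d n ≠ 0) :
    B 0 = -(ecoef q b e 0) / dcoef q a d 0 ∧
    (∀ n : ℕ, 1 ≤ n →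
      B n = gamn q n * ecoef q b e ((n : ℤ) - 1) / dcoef q a d (2 * n - 2) -
        gamn q ((n : ℤ) + 1) * ecoef q b e n / dcoef q a d (2 * n)) ∧
    (∀ n : ℕ,
      Co (n + 1) = -(gamn q ((n : ℤ) + 1) * dcoef q a d ((n : ℤ) - 1) /
          (dcoef q a d (2 * n - 1) * dcoef q a d (2 * n + 1))) *
        phin q a b c d e n (-(ecoef q b e n) / dcoef q a d (2 * n))) := by
  have hal := alp_ne hq0
  -- the first two nontrivial coefficients
  have hF : ∀ n : ℕ, dcoef q a d (2 * n) * cz n (P (n + 1)) =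
      gamn q ((n : ℤ) + 1) * ecoef q b e n := by
    intro n
    have hP := P_top hops (n + 1)
    have hL := (hP.L hq0 hq1 hD hS a b c d e).c1
    rw [eigen hq0 hq1 hD hS hops horth hreg a b c d e hpearson (n + 1), map_smul, smul_eq_mul]
      at hL
    have h2 := F_eq hq0 hq1 a d ((n : ℤ) + 1)
    push_cast at hL h2
    rw [show (2 * ((n : ℤ) + 1) - 2) = 2 * n by ring] at h2
    rw [← h2]
    rw [show ((n : ℤ) + 1 - 1) = n by ring] at *
    linear_combination hL
  have hG : ∀ n : ℕ, 2 * alp q * dcoef q a d (2 * n - 1) * cz ((n : ℤ) - 1) (P (n + 1)) =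
      Rcf q a c d ((n : ℤ) + 1) + gamn q n * ecoef q b e ((n : ℤ) - 1) * cz n (P (n + 1)) := by
    intro n
    have hP := P_top hops (n + 1)
    have hL := (hP.L hq0 hq1 hD hS a b c d e).c2
    rw [eigen hq0 hq1 hD hS hops horth hreg a b c d e hpearson (n + 1), map_smul, smul_eq_mul]
      at hL
    have h2 := G_eq hq0 hq1 a d ((n : ℤ) + 1)
    push_cast at hL h2
    rw [show (2 * ((n : ℤ) + 1) - 3) = 2 * n - 1 by ring] at h2
    rw [← h2]
    unfold Rcf
    rw [show ((n : ℤ) + 1 - 1) = n by ring, show ((n : ℤ) + 1 - 2) = n - 1 by ring] at *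
    linear_combination hL
  -- consequences of the recurrence
  have hB : ∀ n : ℕ, B (n + 1) = cz n (P (n + 1)) - cz ((n + 1 : ℕ) : ℤ) (P (n + 2)) := by
    intro n
    have h1 := P_top hops (n + 1)
    have h0 := P_top hops n
    have ht : P (n + 2) = X * P (n + 1) - Polynomial.C (B (n + 1)) * P (n + 1)
      - Polynomial.C (Co (n + 1)) * P n := by rw [hops.ttrr]; ring
    rw [ht, map_sub, map_sub, cz_X_mul, cz_C_mul, cz_C_mul, h1.c0, h0.hi _ (by push_cast; omega)]
    push_cast
    rw [add_sub_cancel_right]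
    ring
  have hC : ∀ n : ℕ, Co (n + 1) = cz ((n : ℤ) - 1) (P (n + 1)) - cz n (P (n + 2)) -
      B (n + 1) * cz n (P (n + 1)) := by
    intro n
    have h0 := P_top hops n
    have ht : P (n + 2) = X * P (n + 1) - Polynomial.C (B (n + 1)) * P (n + 1)
      - Polynomial.C (Co (n + 1)) * P n := by rw [hops.ttrr]; ring
    rw [ht, map_sub, map_sub, cz_X_mul, cz_C_mul, cz_C_mul, h0.c0]
    ring
  have hFd : ∀ n : ℕ, cz n (P (n + 1)) =
      gamn q ((n : ℤ) + 1) * ecoef q b e n / dcoef q a d (2 * n) := by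
    intro n
    rw [eq_div_iff (hdn _ (by omega)), ← hF n]; ring
  refine ⟨?_, ?_, ?_⟩
  · have h := hFd 0
    have hg : gamn q 1 = 1 := by
      simpa [gam_zero, alp_zero] using gam_succ hq0 hq1 0
    rw [cz_nat] at h
    simp [hops.p1, hg] at h
    rw [neg_div, ← h]
    simp
  · intro n hn
    obtain ⟨m, rfl⟩ : ∃ m : ℕ, n = m + 1 := ⟨n - 1, by omega⟩
    rw [hB, hFd m, hFd (m + 1)]
    push_cast
    rw [add_sub_cancel_right, show (2 * ((m : ℤ) + 1) - 2) = 2 * m by ring]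
  · intro n
    have n0 := hdn (2 * n) (by omega)
    have n1 := hdn (2 * n - 1) (by omega)
    have n2 := hdn (2 * n + 1) (by omega)
    set y := ecoef q b e n / dcoef q a d (2 * n) with hydef
    have hy : ecoef q b e n = y * dcoef q a d (2 * n) := by rw [hydef, div_mul_cancel₀ _ n0]
    have hfin := final_alg hq0 hq1 a b c d e y n hy
    have hF1 : cz n (P (n + 1)) = gamn q ((n : ℤ) + 1) * y := by
      rw [hFd, hydef, mul_div_assoc]
    have hG1 := hG n
    have hG2 := hG (n + 1)
    have hF2 := hF (n + 1)
    have hs := d_sum hq0 hq1 a d (2 * n)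
    push_cast at hG2 hF2
    rw [show (2 * ((n : ℤ) + 1) - 1) = 2 * n + 1 by ring, add_sub_cancel_right,
      show (n : ℤ) + 1 + 1 = n + 2 by ring] at hG2
    rw [show (2 * ((n : ℤ) + 1)) = 2 * n + 2 by ring,
      show (n : ℤ) + 1 + 1 = n + 2 by ring] at hF2
    have hBn := hB n
    push_cast at hBn
    rw [neg_div, ← hydef, hC, hBn, hF1]
    rw [hF1] at hG1
    have hz : cz n (P (n + 1 + 1)) = cz n (P (n + 2)) := rfl
    have hz2 : cz ((n : ℤ) + 1) (P (n + 1 + 1)) = cz ((n : ℤ) + 1) (P (n + 2)) := rfl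
    rw [hz, hz2] at hG2
    rw [hz2] at hF2
    generalize cz ((n : ℤ) + 1) (P (n + 2)) = F2 at *
    generalize cz (n : ℤ) (P (n + 2)) = G2 at *
    generalize cz ((n : ℤ) - 1) (P (n + 1)) = G1 at *
    rw [← sub_eq_zero]
    have hne : 2 * alp q * dcoef q a d (2 * n - 1) * dcoef q a d (2 * n + 1) ≠ 0 := by
      simp [hal, n1, n2]
    apply (mul_eq_zero.mp _).resolve_left hne
    have e1 : 2 * alp q * dcoef q a d (2 * n - 1) * dcoef q a d (2 * n + 1) *
        (G1 - G2 - (gamn q ((n : ℤ) + 1) * y - F2) * (gamn q ((n : ℤ) + 1) * y) -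
        -(gamn q ((n : ℤ) + 1) * dcoef q a d ((n : ℤ) - 1) /
          (dcoef q a d (2 * n - 1) * dcoef q a d (2 * n + 1))) * phin q a b c d e n (-y)) =
        2 * alp q * dcoef q a d (2 * n - 1) * dcoef q a d (2 * n + 1) *
        (G1 - G2 - (gamn q ((n : ℤ) + 1) * y - F2) * (gamn q ((n : ℤ) + 1) * y)) +
        2 * alp q * gamn q ((n : ℤ) + 1) * dcoef q a d ((n : ℤ) - 1) *
          phin q a b c d e n (-y) := by
      field_simp
      ring
    rw [e1]
    linear_combination hfin + dcoef q a d (2 * n + 1) * hG1 - dcoef q a d (2 * n - 1) * hG2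
      + dcoef q a d (2 * n - 1) * gamn q ((n : ℤ) + 1) * y * hF2
      - dcoef q a d (2 * n - 1) * gamn q ((n : ℤ) + 1) * y * F2 * hs
      - dcoef q a d (2 * n - 1) * gamn q ((n : ℤ) + 1) * F2 * hy
end

section
/- Let (P_n)_{n≥0} be a monic OPS with recurrence coefficients (B_n, C_n) satisfying 𝒮_q(𝒟_q P_n) = k_n P_{n−1} for all n ≥ 0, for some constants k_n ∈ ℂ. Then for every n ≥ 2: 2α·U₂·(𝒟_q(𝒟_q P_n)) = a_n P_n + b_n P_{n−1} + c_n P_{n−2}, where a_n = k_{n+1} − (2α²−1)k_n − 1, b_n = (B_n − (2α²−1)B_{n−1})·k_n, and c_n = k_{n−1}C_n − (2α²−1)k_n C_{n−1}. -/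
open Polynomial

lemma aw_poly_ext (T : ℝ) (hT : 1 ≤ T) (f g : ℂ[X])
    (h : ∀ t : ℝ, T < t → f.eval (((t : ℂ) + (t : ℂ)⁻¹) / 2) = g.eval (((t : ℂ) + (t : ℂ)⁻¹) / 2)) :
    f = g := by
  apply Polynomial.eq_of_infinite_eval_eq
  have hinj : Set.InjOn (fun t : ℝ => ((t : ℂ) + (t : ℂ)⁻¹) / 2) (Set.Ioi T) := by
    intro a ha b hb hab
    simp only [Set.mem_Ioi] at ha hb
    have ha0 : a ≠ 0 := by linarith
    have hb0 : b ≠ 0 := by linarith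
    have h1 : (a + a⁻¹) / 2 = (b + b⁻¹) / 2 := by
      have : (((a + a⁻¹) / 2 : ℝ) : ℂ) = (((b + b⁻¹) / 2 : ℝ) : ℂ) := by
        push_cast; exact hab
      exact_mod_cast this
    have h2 : (a - b) * (a * b - 1) = 0 := by
      field_simp at h1
      linear_combination h1
    rcases mul_eq_zero.mp h2 with h3 | h3
    · linarith
    · nlinarith
  refine ((Set.Ioi_infinite T).image hinj).mono ?_
  rintro _ ⟨t, ht, rfl⟩
  exact h t ht

lemma aw_eval (q : ℝ) (D : ℂ[X] → ℂ[X]) (hD : IsAW q D) (p : ℂ[X]) (w x y z : ℂ)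
    (hs : qh q ≠ 0) (hs1 : (qh q) ^ 2 - 1 ≠ 0) (hw : w ≠ 0) (hw1 : w ^ 2 - 1 ≠ 0)
    (hx : x = (w + w⁻¹) / 2)
    (hy : y = (qh q * w + (qh q)⁻¹ * w⁻¹) / 2)
    (hz : z = ((qh q)⁻¹ * w + qh q * w⁻¹) / 2) :
    (D p).eval x = (p.eval y - p.eval z) * (2 * qh q * w) / (((qh q) ^ 2 - 1) * (w ^ 2 - 1)) := by
  rw [hx, hD p w hw (fun h => hw1 (by rw [h]; ring)), ← hy, ← hz]
  have e : ((qh q - (qh q)⁻¹) / 2) * (w - w⁻¹) =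
      (((qh q) ^ 2 - 1) * (w ^ 2 - 1)) / (2 * qh q * w) := by
    field_simp
  rw [e, div_div_eq_mul_div]

lemma aw_key (q : ℝ) (hq0 : 0 < q) (hq1 : q < 1)
    (Dq Sq : ℂ[X] → ℂ[X]) (hD : IsAW q Dq) (hS : IsAv q Sq)
    (h f g : ℂ[X]) (b c : ℂ) (hh : h = (X - C b) * f - C c * g) :
    C (2 * alp q) * U2 q * Dq (Dq f) =
      Sq (Dq h) + C b * Sq (Dq f) + C c * Sq (Dq g) - f
        - C (2 * (alp q) ^ 2 - 1) * X * Sq (Dq f) := by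
  have hr0 : 0 < Real.sqrt q := Real.sqrt_pos.mpr hq0
  have hr1 : Real.sqrt q < 1 := by
    rw [Real.sqrt_lt' one_pos]; simpa using hq1
  have hT : 1 ≤ (Real.sqrt q)⁻¹ := (one_le_inv₀ hr0).mpr hr1.le
  apply aw_poly_ext _ hT
  intro t ht
  have htr : 1 < Real.sqrt q * t := by
    rw [inv_lt_iff_one_lt_mul₀ hr0] at ht; linarith
  have hs : qh q ≠ 0 := by
    unfold qh; exact_mod_cast hr0.ne'
  have hs1 : (qh q) ^ 2 - 1 ≠ 0 := by
    unfold qh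
    have : Real.sqrt q ^ 2 - 1 ≠ 0 := by nlinarith
    exact_mod_cast this
  have ht1 : 1 < t := lt_of_le_of_lt hT ht
  have hw : (t : ℂ) ≠ 0 := by
    have : t ≠ 0 := by linarith
    exact_mod_cast this
  have hw1 : (t : ℂ) ^ 2 - 1 ≠ 0 := by
    have : t ^ 2 - 1 ≠ 0 := by nlinarith
    exact_mod_cast this
  have hw2 : (qh q * t) ^ 2 - 1 ≠ 0 := by
    unfold qh
    have : (Real.sqrt q * t) ^ 2 - 1 ≠ 0 := by nlinarith
    exact_mod_cast this
  have hw3 : (t : ℂ) ^ 2 - (qh q) ^ 2 ≠ 0 := by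
    unfold qh
    have : t ^ 2 - (Real.sqrt q) ^ 2 ≠ 0 := by nlinarith
    exact_mod_cast this
  generalize (t : ℂ) = w at *
  have hw3' : ((qh q)⁻¹ * w) ^ 2 - 1 ≠ 0 := by
    have : ((qh q)⁻¹ * w) ^ 2 - 1 = (w ^ 2 - (qh q) ^ 2) / (qh q) ^ 2 := by field_simp
    rw [this]
    exact div_ne_zero hw3 (pow_ne_zero _ hs)
  obtain ⟨x, hx⟩ : ∃ x, x = (w + w⁻¹) / 2 := ⟨_, rfl⟩
  obtain ⟨y, hy⟩ : ∃ y, y = (qh q * w + (qh q)⁻¹ * w⁻¹) / 2 := ⟨_, rfl⟩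
  obtain ⟨z, hz⟩ : ∃ z, z = ((qh q)⁻¹ * w + qh q * w⁻¹) / 2 := ⟨_, rfl⟩
  obtain ⟨y2, hy2⟩ : ∃ y2, y2 = (qh q * (qh q * w) + (qh q)⁻¹ * (qh q * w)⁻¹) / 2 := ⟨_, rfl⟩
  obtain ⟨z2, hz2⟩ : ∃ z2, z2 = ((qh q)⁻¹ * ((qh q)⁻¹ * w) + qh q * ((qh q)⁻¹ * w)⁻¹) / 2 :=
    ⟨_, rfl⟩
  have Dx := fun p => aw_eval q Dq hD p w x y z hs hs1 hw hw1 hx hy hz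
  have Dy := fun p => aw_eval q Dq hD p (qh q * w) y y2 x hs hs1 (mul_ne_zero hs hw) hw2
    (by rw [hy]; field_simp) hy2 (by rw [hx]; field_simp)
  have Dz := fun p => aw_eval q Dq hD p ((qh q)⁻¹ * w) z x z2 hs hs1
    (mul_ne_zero (inv_ne_zero hs) hw) hw3'
    (by rw [hz]; field_simp) (by rw [hx]; field_simp) hz2
  have Sx : ∀ p, (Sq p).eval x = (p.eval y + p.eval z) / 2 := by
    intro p
    rw [hx, hS p w hw (fun h => hw1 (by rw [h]; ring)), ← hy, ← hz]
  have e3 : ((qh q) ^ 2 - 1) * (((qh q)⁻¹ * w) ^ 2 - 1) =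
      ((qh q) ^ 2 - 1) * (w ^ 2 - (qh q) ^ 2) / (qh q) ^ 2 := by field_simp
  rw [← hx]
  simp only [U2, eval_mul, eval_sub, eval_add, eval_C, eval_X, eval_pow, eval_one, Sx, Dx, Dy, Dz,
    hh, e3, alp]
  generalize f.eval x = f0
  generalize f.eval y2 = f2
  generalize f.eval z2 = f3
  generalize g.eval x = g0
  generalize g.eval y2 = g2
  generalize g.eval z2 = g3
  subst hx hy2 hz2
  clear Dx Dy Dz Sx hy hz y z hh e3 hw3' hD hS
  generalize qh q = s at *
  rw [mul_pow] at *
  field_simp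
  ring

/-- for a monic OPS with `𝒮_q(𝒟_q P_n) = k_n P_{n-1}`, for every `n ≥ 2`,
`2α·U₂·𝒟_q²P_n = a_n P_n + b_n P_{n-1} + c_n P_{n-2}`. -/
theorem stmt_2 (q : ℝ) (hq0 : 0 < q) (hq1 : q < 1)
    (Dq Sq : ℂ[X] → ℂ[X]) (hD : IsAW q Dq) (hS : IsAv q Sq)
    (P : ℕ → ℂ[X]) (B Co : ℕ → ℂ) (hops : MonicOPS P B Co)
    (k : ℕ → ℂ) (hAp : AppellSD Sq Dq P k) :
    ∀ n : ℕ, 2 ≤ n →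
      Polynomial.C (2 * alp q) * U2 q * Dq (Dq (P n)) =
        Polynomial.C (k (n + 1) - (2 * (alp q) ^ 2 - 1) * k n - 1) * P n +
        Polynomial.C ((B n - (2 * (alp q) ^ 2 - 1) * B (n - 1)) * k n) * P (n - 1) +
        Polynomial.C (k (n - 1) * Co n - (2 * (alp q) ^ 2 - 1) * k n * Co (n - 1)) *
          P (n - 2) := by
  intro n hn
  obtain ⟨m, rfl⟩ : ∃ m, n = m + 2 := ⟨n - 2, by omega⟩
  have key := aw_key q hq0 hq1 Dq Sq hD hS _ _ _ _ _ (hops.ttrr (m + 1))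
  have h3 := hAp.2 (m + 2)
  have h2 := hAp.2 (m + 1)
  have h1 := hAp.2 m
  have t := hops.ttrr m
  simp only [show m + 2 - 1 = m + 1 by omega, show m + 2 - 2 = m by omega]
  simp only [add_assoc, Nat.reduceAdd] at key h3 h2 h1 t ⊢
  rw [key, h3, h2, h1]
  simp only [C_mul, C_sub, C_1, C_pow]
  linear_combination ((C 2 * C (alp q) ^ 2 - 1) * C (k (m + 2))) * t
end

section
/- Let (P_n)_{n≥0} be a monic OPS with recurrence coefficients (B_n, C_n) satisfying 𝒮_q(𝒟_q P_n) = k_n P_{n−1} for all n ≥ 0, for some constants k_n ∈ ℂ. Then for every n ≥ 2: 2·𝒮_q(𝒮_q P_n) = 2α_n² P_n + k_n(B_n − B_{n−1}) P_{n−1} + (k_{n−1}C_n − k_n C_{n−1}) P_{n−2}. -/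
open Polynomial

lemma aux_homog (p : ℂ[X]) (n : ℕ) (hp : p.natDegree ≤ n) (a b : ℂ) :
    ∃ h : ℂ[X], (∀ w : ℂ, w ≠ 0 → h.eval w = w ^ n * p.eval ((a * w + b * w⁻¹) / 2)) ∧
      h.eval 0 = (b / 2) ^ n * p.coeff n := by
  refine ⟨∑ i ∈ Finset.range (n + 1),
    C (p.coeff i) * (C (a / 2) * X ^ 2 + C (b / 2)) ^ i * X ^ (n - i), ?_, ?_⟩
  · intro w hw
    rw [Polynomial.eval_eq_sum_range' (Nat.lt_succ_of_le hp), Polynomial.eval_finsetSum,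
      Finset.mul_sum]
    refine Finset.sum_congr rfl fun i hi => ?_
    have hi' : i ≤ n := Nat.lt_succ_iff.mp (Finset.mem_range.mp hi)
    have e1 : w ^ n = w ^ (n - i) * w ^ i := by rw [← pow_add, Nat.sub_add_cancel hi']
    have e2 : (a * w + b * w⁻¹) / 2 * w = a / 2 * w ^ 2 + b / 2 := by
      field_simp
    simp only [eval_mul, eval_pow, eval_add, eval_C, eval_X]
    rw [← e2, e1, mul_pow]
    ring
  · rw [Polynomial.eval_finsetSum, Finset.sum_range_succ, Finset.sum_eq_zero]
    · simp; ring
    · intro i hi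
      have : n - i ≠ 0 := by have := Finset.mem_range.mp hi; omega
      simp [this]

lemma aux_good (s : ℝ) (hs0 : 0 < s) (hs1 : s < 1) (t : ℝ) (ht : s⁻¹ < t) :
    (t : ℂ) ≠ 0 ∧ (t : ℂ) ^ 2 ≠ 1 ∧ ((s : ℂ) * t) ^ 2 ≠ 1 ∧ ((s : ℂ)⁻¹ * t) ^ 2 ≠ 1 := by
  have h1 : 1 < s⁻¹ := (one_lt_inv₀ hs0).mpr hs1
  have h2 : 1 < t := h1.trans ht
  have h3 : 1 < s * t := by
    have := mul_lt_mul_of_pos_left ht hs0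
    rwa [mul_inv_cancel₀ hs0.ne'] at this
  have h4 : 1 < s⁻¹ * t := by nlinarith
  have key : ∀ x : ℝ, 1 < x → x ^ 2 ≠ 1 := fun x hx => by nlinarith
  refine ⟨?_, ?_, ?_, ?_⟩
  · exact_mod_cast (by linarith : t ≠ 0)
  · exact_mod_cast key t h2
  · exact_mod_cast key _ h3
  · have := key _ h4
    exact_mod_cast this

lemma aux_ext (T : ℝ) (hT : 1 < T) (p r : ℂ[X])
    (h : ∀ t : ℝ, T < t → p.eval (((t : ℂ) + (t : ℂ)⁻¹) / 2) = r.eval (((t : ℂ) + (t : ℂ)⁻¹) / 2)) :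
    p = r := by
  refine Polynomial.eq_of_infinite_eval_eq p r ?_
  have hinj : Set.InjOn (fun t : ℝ => ((t : ℂ) + (t : ℂ)⁻¹) / 2) (Set.Ioi T) := by
    intro x hx y hy hxy
    have hx1 : 1 < x := hT.trans hx
    have hy1 : 1 < y := hT.trans hy
    have h2 : (x + x⁻¹) / 2 = (y + y⁻¹) / 2 := by
      have h3 : ((((x + x⁻¹) / 2 : ℝ)) : ℂ) = (((y + y⁻¹) / 2 : ℝ) : ℂ) := by
        push_cast; exact hxy
      exact_mod_cast h3
    have hx0 : x ≠ 0 := by linarith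
    have hy0 : y ≠ 0 := by linarith
    field_simp at h2
    have h4 : (x - y) * (x * y - 1) = 0 := by linear_combination h2
    rcases mul_eq_zero.mp h4 with h5 | h5
    · linarith
    · nlinarith
  refine ((Set.Ioi_infinite T).image hinj).mono ?_
  rintro _ ⟨t, ht, rfl⟩
  exact h t ht

lemma aux_ext' (T : ℝ) (p r : ℂ[X])
    (h : ∀ t : ℝ, T < t → p.eval (t : ℂ) = r.eval (t : ℂ)) : p = r := by
  refine Polynomial.eq_of_infinite_eval_eq p r ?_
  refine ((Set.Ioi_infinite T).image
    (f := fun t : ℝ => (t : ℂ)) Complex.ofReal_injective.injOn).mono ?_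
  rintro _ ⟨t, ht, rfl⟩
  exact h t ht

/-- for a monic OPS with `𝒮_q(𝒟_q P_n) = k_n P_{n-1}`, for every `n ≥ 2`,
`2·𝒮_q²P_n = 2α_n² P_n + k_n(B_n − B_{n−1}) P_{n−1} + (k_{n−1}C_n − k_n C_{n−1}) P_{n−2}`. -/
theorem stmt_4 (q : ℝ) (hq0 : 0 < q) (hq1 : q < 1)
    (Dq Sq : ℂ[X] → ℂ[X]) (hD : IsAW q Dq) (hS : IsAv q Sq)
    (P : ℕ → ℂ[X]) (B Co : ℕ → ℂ) (hops : MonicOPS P B Co)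
    (k : ℕ → ℂ) (hAp : AppellSD Sq Dq P k) :
    ∀ n : ℕ, 2 ≤ n →
      Polynomial.C (2 : ℂ) * Sq (Sq (P n)) =
        Polynomial.C (2 * (alpn q n) ^ 2) * P n +
        Polynomial.C (k n * (B n - B (n - 1))) * P (n - 1) +
        Polynomial.C (k (n - 1) * Co n - k n * Co (n - 1)) * P (n - 2) := by
  intro n hn
  obtain ⟨m, rfl⟩ : ∃ m, n = m + 2 := ⟨n - 2, by omega⟩
  have hm1 : m + 2 - 1 = m + 1 := by omega
  have hm2 : m + 2 - 2 = m := by omega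
  rw [hm1, hm2]
  obtain ⟨s, hsdef⟩ : ∃ s, s = Real.sqrt q := ⟨_, rfl⟩
  have hs0 : 0 < s := by rw [hsdef]; exact Real.sqrt_pos.mpr hq0
  have hs1 : s < 1 := by rw [hsdef, Real.sqrt_lt' one_pos]; simpa using hq1
  have hqh : qh q = (s : ℂ) := by rw [hsdef]; rfl
  have hsc : (s : ℂ) ≠ 0 := by exact_mod_cast hs0.ne'
  have hcc : (s : ℂ) - (s : ℂ)⁻¹ ≠ 0 := by
    have h1 : 1 < s⁻¹ := (one_lt_inv₀ hs0).mpr hs1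
    have : s - s⁻¹ ≠ 0 := by linarith
    exact_mod_cast this
  have hT : 1 < s⁻¹ := (one_lt_inv₀ hs0).mpr hs1
  -- evaluation of S S
  have evSS : ∀ p : ℂ[X], ∀ t : ℝ, s⁻¹ < t →
      (Sq (Sq p)).eval (((t : ℂ) + (t : ℂ)⁻¹) / 2) =
        (p.eval (((s : ℂ) ^ 2 * t + ((s : ℂ)⁻¹) ^ 2 * (t : ℂ)⁻¹) / 2)
          + 2 * p.eval (((t : ℂ) + (t : ℂ)⁻¹) / 2)
          + p.eval ((((s : ℂ)⁻¹) ^ 2 * t + (s : ℂ) ^ 2 * (t : ℂ)⁻¹) / 2)) / 4 := by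
    intro p t ht
    obtain ⟨h0, h1, h2, h3⟩ := aux_good s hs0 hs1 t ht
    have e := hS (Sq p) t h0 h1
    have e1 := hS p (s * t) (mul_ne_zero hsc h0) h2
    have e2 := hS p ((s : ℂ)⁻¹ * t) (mul_ne_zero (inv_ne_zero hsc) h0) h3
    rw [hqh] at e e1 e2
    rw [mul_inv] at e1 e2
    rw [inv_inv] at e2
    rw [e, e1, e2]
    have a1 : (s : ℂ) * (s * t) + (s : ℂ)⁻¹ * ((s : ℂ)⁻¹ * (t : ℂ)⁻¹) =
      (s : ℂ) ^ 2 * t + ((s : ℂ)⁻¹) ^ 2 * (t : ℂ)⁻¹ := by ring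
    have a2 : (s : ℂ)⁻¹ * (s * t) + (s : ℂ) * ((s : ℂ)⁻¹ * (t : ℂ)⁻¹) = t + (t : ℂ)⁻¹ := by
      field_simp
    have a3 : (s : ℂ) * ((s : ℂ)⁻¹ * t) + (s : ℂ)⁻¹ * (s * (t : ℂ)⁻¹) = t + (t : ℂ)⁻¹ := by
      field_simp
    have a4 : (s : ℂ)⁻¹ * ((s : ℂ)⁻¹ * t) + (s : ℂ) * (s * (t : ℂ)⁻¹) =
      ((s : ℂ)⁻¹) ^ 2 * t + (s : ℂ) ^ 2 * (t : ℂ)⁻¹ := by ring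
    rw [a1, a2, a3, a4]
    ring
  -- evaluation of S D
  have evSD : ∀ t : ℝ, s⁻¹ < t → ∃ x y z d e : ℂ, d ≠ 0 ∧ e ≠ 0 ∧ x - y = d ∧ y - z = e ∧
      x = ((s : ℂ) ^ 2 * t + ((s : ℂ)⁻¹) ^ 2 * (t : ℂ)⁻¹) / 2 ∧
      y = ((t : ℂ) + (t : ℂ)⁻¹) / 2 ∧
      z = (((s : ℂ)⁻¹) ^ 2 * t + (s : ℂ) ^ 2 * (t : ℂ)⁻¹) / 2 ∧
      ∀ p : ℂ[X], (Sq (Dq p)).eval y =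
        ((p.eval x - p.eval y) / d + (p.eval y - p.eval z) / e) / 2 := by
    intro t ht
    obtain ⟨h0, h1, h2, h3⟩ := aux_good s hs0 hs1 t ht
    have g : ∀ u : ℂ, u ≠ 0 → u ^ 2 ≠ 1 → u - u⁻¹ ≠ 0 := by
      intro u hu hu2 h
      apply hu2
      field_simp at h
      linear_combination h
    refine ⟨_, _, _, ((s : ℂ) - (s : ℂ)⁻¹) / 2 * (s * t - (s * t : ℂ)⁻¹),
      ((s : ℂ) - (s : ℂ)⁻¹) / 2 * ((s : ℂ)⁻¹ * t - ((s : ℂ)⁻¹ * t)⁻¹), ?_, ?_, ?_, ?_,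
      rfl, rfl, rfl, ?_⟩
    · exact mul_ne_zero (div_ne_zero hcc two_ne_zero) (g _ (mul_ne_zero hsc h0) h2)
    · exact mul_ne_zero (div_ne_zero hcc two_ne_zero)
        (g _ (mul_ne_zero (inv_ne_zero hsc) h0) h3)
    · field_simp; ring
    · field_simp; ring
    intro p
    have e := hS (Dq p) t h0 h1
    have e1 := hD p (s * t) (mul_ne_zero hsc h0) h2
    have e2 := hD p ((s : ℂ)⁻¹ * t) (mul_ne_zero (inv_ne_zero hsc) h0) h3
    rw [hqh] at e e1 e2
    have i1 : ((s : ℂ) * t)⁻¹ = (s : ℂ)⁻¹ * (t : ℂ)⁻¹ := mul_inv _ _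
    have i2 : ((s : ℂ)⁻¹ * t)⁻¹ = (s : ℂ) * (t : ℂ)⁻¹ := by rw [mul_inv, inv_inv]
    rw [i1] at e1 ⊢
    rw [i2] at e2 ⊢
    rw [e, e1, e2]
    have a1 : (s : ℂ) * (s * t) + (s : ℂ)⁻¹ * ((s : ℂ)⁻¹ * (t : ℂ)⁻¹) =
      (s : ℂ) ^ 2 * t + ((s : ℂ)⁻¹) ^ 2 * (t : ℂ)⁻¹ := by ring
    have a2 : (s : ℂ)⁻¹ * (s * t) + (s : ℂ) * ((s : ℂ)⁻¹ * (t : ℂ)⁻¹) = t + (t : ℂ)⁻¹ := by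
      field_simp
    have a3 : (s : ℂ) * ((s : ℂ)⁻¹ * t) + (s : ℂ)⁻¹ * (s * (t : ℂ)⁻¹) = t + (t : ℂ)⁻¹ := by
      field_simp
    have a4 : (s : ℂ)⁻¹ * ((s : ℂ)⁻¹ * t) + (s : ℂ) * (s * (t : ℂ)⁻¹) =
      ((s : ℂ)⁻¹) ^ 2 * t + (s : ℂ) ^ 2 * (t : ℂ)⁻¹ := by ring
    rw [a1, a2, a3, a4]
  -- the identity with unknown leading coefficient
  have key : Polynomial.C (2 : ℂ) * Sq (Sq (P (m + 2))) =
        Polynomial.C (k (m + 3) - k (m + 2) + 1) * P (m + 2) +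
        Polynomial.C (k (m + 2) * (B (m + 2) - B (m + 1))) * P (m + 1) +
        Polynomial.C (k (m + 1) * Co (m + 2) - k (m + 2) * Co (m + 1)) * P m := by
    refine aux_ext s⁻¹ hT _ _ fun t ht => ?_
    have hss := evSS (P (m + 2)) t ht
    obtain ⟨x, y, z, d, e, hd, he, hxy, hyz, hx, hy, hz, hsd⟩ := evSD t ht
    rw [← hx, ← hy, ← hz] at hss
    rw [← hy]
    have r : ∀ u : ℂ, (P (m + 3)).eval u = (u - B (m + 2)) * (P (m + 2)).eval u -
        Co (m + 2) * (P (m + 1)).eval u := by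
      intro u
      rw [hops.ttrr (m + 1)]
      simp
    have r' : (P (m + 2)).eval y = (y - B (m + 1)) * (P (m + 1)).eval y -
        Co (m + 1) * (P m).eval y := by
      rw [hops.ttrr m]
      simp
    have k3 := hsd (P (m + 3))
    have k2 := hsd (P (m + 2))
    have k1 := hsd (P (m + 1))
    rw [hAp.2 (m + 2), eval_mul, eval_C] at k3
    rw [hAp.2 (m + 1), eval_mul, eval_C] at k2
    rw [hAp.2 m, eval_mul, eval_C] at k1
    rw [r, r, r] at k3
    simp only [eval_add, eval_mul, eval_C]
    rw [hss]
    have hx' : x = y + d := by linear_combination hxy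
    have hz' : z = y - e := by linear_combination -hyz
    have hK3 : k (m + 3) * (P (m + 2)).eval y =
        ((P (m + 2)).eval x + (P (m + 2)).eval z) / 2
        + (y - B (m + 2)) * (k (m + 2) * (P (m + 1)).eval y)
        - Co (m + 2) * (k (m + 1) * (P m).eval y) := by
      rw [k2, k1, k3]
      generalize (P (m + 2)).eval x = X2 at *
      generalize (P (m + 2)).eval y = Y2 at *
      generalize (P (m + 2)).eval z = Z2 at *
      rw [hx', hz']
      field_simp
      ring
    linear_combination -hK3 + k (m + 2) * r'
  -- leading coefficient
  have hdeg := hops.deg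
  have hlead : k (m + 3) - k (m + 2) + 1 = 2 * (alpn q ((m + 2 : ℕ) : ℤ)) ^ 2 := by
    set c := k (m + 3) - k (m + 2) + 1 with hc
    set R := Polynomial.C c * P (m + 2) +
        Polynomial.C (k (m + 2) * (B (m + 2) - B (m + 1))) * P (m + 1) +
        Polynomial.C (k (m + 1) * Co (m + 2) - k (m + 2) * Co (m + 1)) * P m with hR
    have hRd : R.natDegree ≤ m + 2 := by
      refine natDegree_add_le_of_degree_le (natDegree_add_le_of_degree_le ?_ ?_) ?_
      · exact (natDegree_C_mul_le _ _).trans (hdeg _).le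
      · exact (natDegree_C_mul_le _ _).trans ((hdeg _).le.trans (by omega))
      · exact (natDegree_C_mul_le _ _).trans ((hdeg _).le.trans (by omega))
    have l2 : (P (m + 2)).coeff (m + 2) = 1 := by
      have := (hops.monic (m + 2)).coeff_natDegree
      rwa [hdeg] at this
    have hRc : R.coeff (m + 2) = c := by
      rw [hR, coeff_add, coeff_add, coeff_C_mul, coeff_C_mul, coeff_C_mul, l2,
        coeff_eq_zero_of_natDegree_lt (p := P (m + 1)) (by rw [hdeg]; omega),
        coeff_eq_zero_of_natDegree_lt (p := P m) (by rw [hdeg]; omega)]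
      ring
    obtain ⟨f1, f1e, f10⟩ := aux_homog (P (m + 2)) (m + 2) (hdeg _).le
      ((s : ℂ) ^ 2) (((s : ℂ)⁻¹) ^ 2)
    obtain ⟨f2, f2e, f20⟩ := aux_homog (P (m + 2)) (m + 2) (hdeg _).le 1 1
    obtain ⟨f3, f3e, f30⟩ := aux_homog (P (m + 2)) (m + 2) (hdeg _).le
      (((s : ℂ)⁻¹) ^ 2) ((s : ℂ) ^ 2)
    obtain ⟨f4, f4e, f40⟩ := aux_homog R (m + 2) hRd 1 1
    have hf : f1 + C 2 * f2 + f3 = C 2 * f4 := by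
      refine aux_ext' s⁻¹ _ _ fun t ht => ?_
      have h0 := (aux_good s hs0 hs1 t ht).1
      have hss := evSS (P (m + 2)) t ht
      have hk := congrArg (fun p => p.eval (((t : ℂ) + (t : ℂ)⁻¹) / 2)) key
      simp only [eval_mul, eval_C] at hk
      simp only [eval_add, eval_mul, eval_C]
      rw [f1e _ h0, f2e _ h0, f3e _ h0, f4e _ h0, one_mul, one_mul, ← hk, hss]
      ring
    have h0 := congrArg (fun p => p.eval 0) hf
    simp only [eval_add, eval_mul, eval_C] at h0
    rw [f10, f20, f30, f40, l2, hRc] at h0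
    simp only [div_pow] at h0
    have h2 : (2 : ℂ) ^ (m + 2) ≠ 0 := pow_ne_zero _ two_ne_zero
    have hsn : (s : ℂ) ^ (m + 2) ≠ 0 := pow_ne_zero _ hsc
    have h3 : (((s : ℂ)⁻¹) ^ 2) ^ (m + 2) + 2 + ((s : ℂ) ^ 2) ^ (m + 2) = 2 * c := by
      apply mul_right_cancel₀ (inv_ne_zero h2)
      rw [one_pow] at h0
      linear_combination h0
    unfold alpn
    rw [hqh, zpow_neg, zpow_natCast]
    have h4 : (((s : ℂ)⁻¹) ^ 2) ^ (m + 2) = (((s : ℂ) ^ (m + 2))⁻¹) ^ 2 := by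
      rw [← pow_mul, mul_comm, pow_mul, inv_pow]
    have h5 : ((s : ℂ) ^ 2) ^ (m + 2) = ((s : ℂ) ^ (m + 2)) ^ 2 := by
      rw [← pow_mul, mul_comm, pow_mul]
    rw [h4, h5] at h3
    have h6 : (s : ℂ) ^ (m + 2) * ((s : ℂ) ^ (m + 2))⁻¹ = 1 := mul_inv_cancel₀ hsn
    linear_combination -(1 / 2) * h3 - h6
  rw [key, hlead]
end

section
/- Let (P_n)_{n≥0} be a monic OPS with recurrence coefficients (B_n, C_n) satisfying 𝒮_q(𝒟_q P_n) = k_n P_{n−1} for all n ≥ 0, for some constants k_n ∈ ℂ. Set t_n = k_n/C_n for n ≥ 1. Then for all n ≥ 1: (k_{n+2} − 1/2) − 2(2α² − 1)(k_{n+1} − 1/2) + (k_n − 1/2) = 0, and t_{n+2} − 2(2α² − 1)t_{n+1} + t_n = 0. -/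
open Polynomial

lemma aw_pt (r w : ℂ) (hr : r ≠ 0) (hr1 : r ^ 2 ≠ 1) (hw : w ≠ 0) (hrw : (r * w) ^ 2 ≠ 1)
    (hwr : (r⁻¹ * w) ^ 2 ≠ 1) :
    ((2 - (r ^ 2 + (r ^ 2)⁻¹)) * ((w + w⁻¹) / 2) ^ 2 + (r ^ 2 - (r ^ 2)⁻¹) ^ 2 / 4) *
      (1 / (((r - r⁻¹) / 2) * (r * w - (r * w)⁻¹)) / 2 -
        1 / (((r - r⁻¹) / 2) * (r⁻¹ * w - (r⁻¹ * w)⁻¹)) / 2) =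
      ((w + w⁻¹) / 2) * ((r ^ 2 + (r ^ 2)⁻¹) - 2) / 2 := by
  have h1 : r ^ 2 - 1 ≠ 0 := sub_ne_zero.2 hr1
  have h2 : r ^ 2 * w ^ 2 - 1 ≠ 0 := by
    rw [← mul_pow]; exact sub_ne_zero.2 hrw
  have h3 : w ^ 2 - r ^ 2 ≠ 0 := by
    intro h
    apply hwr
    rw [mul_pow, inv_pow, sub_eq_zero.1 h]
    exact inv_mul_cancel₀ (pow_ne_zero 2 hr)
  have e1 : r - r⁻¹ = (r ^ 2 - 1) / r := by field_simp
  have e2 : r * w - (r * w)⁻¹ = (r ^ 2 * w ^ 2 - 1) / (r * w) := by field_simp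
  have e3 : r⁻¹ * w - (r⁻¹ * w)⁻¹ = (w ^ 2 - r ^ 2) / (r * w) := by field_simp
  rw [e1, e2, e3]
  field_simp
  ring

lemma aw_T (q : ℝ) (hq0 : 0 < q) (hq1 : q < 1)
    (Dq Sq : ℂ[X] → ℂ[X]) (hD : IsAW q Dq) (hS : IsAv q Sq) (w : ℂ)
    (hw : w ≠ 0) (hw1 : w ^ 2 ≠ 1) (hrw : (qh q * w) ^ 2 ≠ 1)
    (hwr : ((qh q)⁻¹ * w) ^ 2 ≠ 1) (hr : qh q ≠ 0) (hr1 : qh q ^ 2 ≠ 1) :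
    ∃ y z A A' : ℂ, (∀ p : ℂ[X], (Sq (Dq p)).eval ((w + w⁻¹) / 2) =
        A * (p.eval y - p.eval ((w + w⁻¹) / 2)) + A' * (p.eval z - p.eval ((w + w⁻¹) / 2))) ∧
      ((w + w⁻¹) / 2) ^ 2 + y ^ 2 - (qh q ^ 2 + (qh q ^ 2)⁻¹) * ((w + w⁻¹) / 2) * y =
        -(qh q ^ 2 - (qh q ^ 2)⁻¹) ^ 2 / 4 ∧
      ((w + w⁻¹) / 2) ^ 2 + z ^ 2 - (qh q ^ 2 + (qh q ^ 2)⁻¹) * ((w + w⁻¹) / 2) * z =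
        -(qh q ^ 2 - (qh q ^ 2)⁻¹) ^ 2 / 4 ∧
      ((2 - (qh q ^ 2 + (qh q ^ 2)⁻¹)) * ((w + w⁻¹) / 2) ^ 2 +
        (qh q ^ 2 - (qh q ^ 2)⁻¹) ^ 2 / 4) * (A + A') =
        ((w + w⁻¹) / 2) * ((qh q ^ 2 + (qh q ^ 2)⁻¹) - 2) / 2 := by
  have key := aw_pt (qh q) w hr hr1 hw hrw hwr
  have hD' := hD
  have hS' := hS
  unfold IsAW at hD'
  unfold IsAv at hS'
  generalize qh q = r at *
  refine ⟨(r ^ 2 * w + (r ^ 2 * w)⁻¹) / 2, ((r ^ 2)⁻¹ * w + r ^ 2 * w⁻¹) / 2,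
    1 / (((r - r⁻¹) / 2) * (r * w - (r * w)⁻¹)) / 2,
    -(1 / (((r - r⁻¹) / 2) * (r⁻¹ * w - (r⁻¹ * w)⁻¹)) / 2), ?_, ?_, ?_, ?_⟩
  · intro p
    have h1 := hD' p (r * w) (mul_ne_zero hr hw) hrw
    have h2 := hD' p (r⁻¹ * w) (mul_ne_zero (inv_ne_zero hr) hw) hwr
    have e1 : (r * (r * w) + r⁻¹ * (r * w)⁻¹) / 2 = (r ^ 2 * w + (r ^ 2 * w)⁻¹) / 2 := by
      field_simp
    have e2 : (r⁻¹ * (r * w) + r * (r * w)⁻¹) / 2 = (w + w⁻¹) / 2 := by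
      field_simp
    have e3 : (r * (r⁻¹ * w) + r⁻¹ * (r⁻¹ * w)⁻¹) / 2 = (w + w⁻¹) / 2 := by
      field_simp
    have e4 : (r⁻¹ * (r⁻¹ * w) + r * (r⁻¹ * w)⁻¹) / 2 = ((r ^ 2)⁻¹ * w + r ^ 2 * w⁻¹) / 2 := by
      field_simp
    have e5 : (r * w + (r * w)⁻¹) / 2 = (r * w + r⁻¹ * w⁻¹) / 2 := by
      field_simp
    have e6 : (r⁻¹ * w + (r⁻¹ * w)⁻¹) / 2 = (r⁻¹ * w + r * w⁻¹) / 2 := by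
      field_simp
    rw [e1, e2, e5] at h1
    rw [e3, e4, e6] at h2
    rw [hS' _ w hw hw1, h1, h2]
    ring
  · field_simp; ring
  · field_simp; ring
  · rw [← key]; ring

lemma aw_inf (q : ℝ) (hq0 : 0 < q) (hq1 : q < 1) (f g : ℂ[X])
    (h : ∀ w : ℂ, w ≠ 0 → w ^ 2 ≠ 1 → (qh q * w) ^ 2 ≠ 1 → ((qh q)⁻¹ * w) ^ 2 ≠ 1 →
      f.eval ((w + w⁻¹) / 2) = g.eval ((w + w⁻¹) / 2)) : f = g := by
  set r := Real.sqrt q with hr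
  have hr0 : 0 < r := Real.sqrt_pos.2 hq0
  have hr1 : r < 1 := by
    rw [hr, Real.sqrt_lt' one_pos]; simpa using hq1
  have hri : 1 < r⁻¹ := (one_lt_inv₀ hr0).2 hr1
  have gt1 : ∀ x : ℝ, 1 < x → x ^ 2 ≠ 1 := fun x hx => by nlinarith
  apply Polynomial.eq_of_infinite_eval_eq
  apply Set.Infinite.mono (s := (fun w : ℝ => (((w + w⁻¹) / 2 : ℝ) : ℂ)) '' Set.Ioi r⁻¹)
  · rintro _ ⟨w, hw, rfl⟩
    have hw : r⁻¹ < w := hw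
    have hw0 : 0 < w := by linarith
    have a1 : 1 < r * w := by
      have := mul_lt_mul_of_pos_left hw hr0
      rwa [mul_inv_cancel₀ hr0.ne'] at this
    have a2 : 1 < r⁻¹ * w := by nlinarith
    have := h w (by exact_mod_cast hw0.ne') (by exact_mod_cast gt1 w (by linarith))
      (by unfold qh; exact_mod_cast gt1 _ a1) (by unfold qh; exact_mod_cast gt1 _ a2)
    simpa using this
  · apply Set.Infinite.image
    · intro a ha b hb hab
      have ha : r⁻¹ < a := ha
      have hb : r⁻¹ < b := hb
      have hab : (a + a⁻¹) / 2 = (b + b⁻¹) / 2 := by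
        have h := hab
        simp only [Complex.ofReal_inj] at h
        exact h
      have ha0 : a ≠ 0 := by linarith
      have hb0 : b ≠ 0 := by linarith
      have h3 : (a - b) * (a * b - 1) = 0 := by
        field_simp at hab
        linear_combination hab
      rcases mul_eq_zero.1 h3 with h | h
      · linarith
      · nlinarith
    · exact Set.Ioi_infinite _

lemma coeff_lt (P : ℕ → ℂ[X]) (B Co : ℕ → ℂ) (hops : MonicOPS P B Co) (i m : ℕ) (h : i < m) :
    (P i).coeff m = 0 := by
  apply Polynomial.coeff_eq_zero_of_natDegree_lt
  rw [hops.deg]; exact h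

lemma coeff_self' (P : ℕ → ℂ[X]) (B Co : ℕ → ℂ) (hops : MonicOPS P B Co) (m : ℕ) :
    (P m).coeff m = 1 := by
  have := hops.monic m
  rwa [Polynomial.Monic, Polynomial.leadingCoeff, hops.deg] at this

/-- Comparing coefficients in five consecutive members of the sequence. -/
lemma rel_expand (T : ℂ[X] → ℂ[X]) (hadd : ∀ p p', T (p + p') = T p + T p')
    (hsmul : ∀ (a : ℂ) p, T (Polynomial.C a * p) = Polynomial.C a * T p) (s κ : ℂ)
    (hrel : ∀ p, X ^ 2 * T p - Polynomial.C s * (X * T (X * p)) + T (X * (X * p)) =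
      Polynomial.C κ * T p - Polynomial.C ((s - 2) / 2) * (X * p))
    (Q : ℕ → ℂ[X]) (b c k : ℕ → ℂ)
    (j : ℕ)
    (hX : ∀ i, j < i → X * Q (i + 1) =
      Q (i + 2) + Polynomial.C (b (i + 1)) * Q (i + 1) + Polynomial.C (c (i + 1)) * Q i)
    (x1c : Polynomial.C (c (j + 2)) * (X * Q (j + 1)) = Polynomial.C (c (j + 2)) *
      (Q (j + 2) + Polynomial.C (b (j + 1)) * Q (j + 1) + Polynomial.C (c (j + 1)) * Q j))
    (x1k : Polynomial.C (k (j + 2)) * (X * Q (j + 1)) = Polynomial.C (k (j + 2)) *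
      (Q (j + 2) + Polynomial.C (b (j + 1)) * Q (j + 1) + Polynomial.C (c (j + 1)) * Q j))
    (hT : ∀ j, T (Q (j + 1)) = Polynomial.C (k (j + 1)) * Q j) :
    ∃ d1 d2 d3 : ℂ,
      Polynomial.C (k (j + 3) - s * k (j + 4) + k (j + 5) + (s - 2) / 2) * Q (j + 4) +
      Polynomial.C d3 * Q (j + 3) + Polynomial.C d2 * Q (j + 2) + Polynomial.C d1 * Q (j + 1) +
      Polynomial.C (k (j + 3) * c (j + 2) * c (j + 1) - s * (c (j + 3) * k (j + 2) * c (j + 1))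
        + c (j + 3) * c (j + 2) * k (j + 1)) * Q j = 0 := by
  have hr := hrel (Q (j + 3))
  have x2 := hX (j + 1) (by omega)
  have x3 := hX (j + 2) (by omega)
  have x4 := hX (j + 3) (by omega)
  have e2 : X * (X * Q (j + 3)) = X * Q (j + 4) + Polynomial.C (b (j + 3)) * (X * Q (j + 3)) +
      Polynomial.C (c (j + 3)) * (X * Q (j + 2)) := by
    linear_combination (X : ℂ[X]) * x3
  have t1 := hT j
  have t2 := hT (j + 1)
  have t3 := hT (j + 2)
  have t4 := hT (j + 3)
  have t5 := hT (j + 4)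
  simp only [add_assoc, Nat.reduceAdd] at x2 x3 x4 t1 t2 t3 t4 t5
  rw [e2, x4, x3, x2] at hr
  simp only [hadd, hsmul, t1, t2, t3, t4, t5] at hr
  refine ⟨k (j + 3) * (b (j + 2) + b (j + 1)) * c (j + 2)
      - s * (b (j + 3) * k (j + 3) * c (j + 2) + c (j + 3) * k (j + 2) * b (j + 1))
      + b (j + 3) * c (j + 3) * k (j + 2) + c (j + 3) * b (j + 2) * k (j + 2) ,
     k (j + 3) * (c (j + 3) + b (j + 2) ^ 2 + c (j + 2))
      - s * (k (j + 4) * c (j + 3) + b (j + 3) ^ 2 * 0 + b (j + 3) * k (j + 3) * b (j + 2)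
          + c (j + 3) * k (j + 2))
      + c (j + 4) * k (j + 3) + b (j + 3) ^ 2 * k (j + 3) + c (j + 3) * k (j + 3)
      - κ * k (j + 3) + (s - 2) / 2 * c (j + 3),
     k (j + 3) * (b (j + 3) + b (j + 2))
      - s * (k (j + 4) * b (j + 3) + b (j + 3) * k (j + 3))
      + b (j + 4) * k (j + 4) + b (j + 3) * k (j + 4) + (s - 2) / 2 * b (j + 3), ?_⟩
  simp only [map_add, map_sub, map_mul, map_zero, map_pow]
  linear_combination hr - Polynomial.C (k (j + 3)) * ((X : ℂ[X]) * x2 + x3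
    + Polynomial.C (b (j + 2)) * x2 + x1c)
    + Polynomial.C s * (Polynomial.C (k (j + 4)) * x3 +
      Polynomial.C (b (j + 3)) * Polynomial.C (k (j + 3)) * x2
      + Polynomial.C (c (j + 3)) * x1k)

lemma appell_core (T : ℂ[X] → ℂ[X]) (hadd : ∀ p p', T (p + p') = T p + T p')
    (hsmul : ∀ (a : ℂ) p, T (Polynomial.C a * p) = Polynomial.C a * T p) (s κ : ℂ)
    (hrel : ∀ p, X ^ 2 * T p - Polynomial.C s * (X * T (X * p)) + T (X * (X * p)) =
      Polynomial.C κ * T p - Polynomial.C ((s - 2) / 2) * (X * p))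
    (P : ℕ → ℂ[X]) (B Co : ℕ → ℂ) (hops : MonicOPS P B Co)
    (k : ℕ → ℂ) (h0 : T (P 0) = 0) (hT : ∀ n, T (P (n + 1)) = Polynomial.C (k (n + 1)) * P n) :
    (∀ n, 1 ≤ n → k n - s * k (n + 1) + k (n + 2) + (s - 2) / 2 = 0) ∧
    ∀ n, 1 ≤ n → k (n + 2) * Co (n + 1) * Co n - s * (Co (n + 2) * k (n + 1) * Co n)
        + Co (n + 2) * Co (n + 1) * k n = 0 := by
  have T0 : T 0 = 0 := by simpa using hsmul 0 0
  have hX : ∀ i, X * P (i + 1) =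
      P (i + 2) + Polynomial.C (B (i + 1)) * P (i + 1) + Polynomial.C (Co (i + 1)) * P i := by
    intro i
    rw [hops.ttrr i]; ring
  have hs := coeff_self' P B Co hops
  have hl := coeff_lt P B Co hops
  constructor
  · obtain ⟨Q, Q0, Q1, Q2, Q3⟩ : ∃ Q : ℕ → ℂ[X], Q 0 = 0 ∧ Q 1 = 0 ∧ Q 2 = 0 ∧
        ∀ j, Q (j + 3) = P j :=
      ⟨fun j => match j with | 0 => 0 | 1 => 0 | 2 => 0 | j + 3 => P j, rfl, rfl, rfl,
        fun _ => rfl⟩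
    obtain ⟨c, c3, c4⟩ : ∃ c : ℕ → ℂ, c 3 = 0 ∧ ∀ j, c (j + 4) = Co (j + 1) :=
      ⟨fun j => match j with | 0 => 0 | 1 => 0 | 2 => 0 | 3 => 0 | j + 4 => Co (j + 1), rfl,
        fun _ => rfl⟩
    obtain ⟨l, l3, l4⟩ : ∃ l : ℕ → ℂ, l 3 = 0 ∧ ∀ j, l (j + 4) = k (j + 1) :=
      ⟨fun j => match j with | 0 => 0 | 1 => 0 | 2 => 0 | 3 => 0 | j + 4 => k (j + 1), rfl,
        fun _ => rfl⟩
    have hXQ : ∀ i, 1 < i → X * Q (i + 1) =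
        Q (i + 2) + Polynomial.C (B (i + 1 - 3)) * Q (i + 1) + Polynomial.C (c (i + 1)) * Q i := by
      intro i hi
      match i with
      | 2 =>
        have e3 := Q3 0
        have e4 := Q3 1
        simp only [Nat.reduceAdd, zero_add] at e3 e4 ⊢
        rw [e3, e4, Q2, c3, hops.p0, hops.p1]
        simp
      | i + 3 =>
        have e4 : Q (i + 3 + 1) = P (i + 1) := Q3 (i + 1)
        have e5 : Q (i + 3 + 2) = P (i + 2) := Q3 (i + 2)
        have ec : c (i + 3 + 1) = Co (i + 1) := c4 i
        have eb : i + 3 + 1 - 3 = i + 1 := by omega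
        rw [e4, e5, Q3, ec, eb]
        exact hX i
    have hTQ : ∀ j, T (Q (j + 1)) = Polynomial.C (l (j + 1)) * Q j := by
      intro j
      match j with
      | 0 => simp [Q0, Q1, T0]
      | 1 => simp [Q1, Q2, T0]
      | 2 =>
        have e3 := Q3 0
        simp only [Nat.reduceAdd, zero_add] at e3 ⊢
        rw [e3, Q2, h0, mul_zero]
      | j + 3 =>
        have e4 : Q (j + 3 + 1) = P (j + 1) := Q3 (j + 1)
        have el : l (j + 3 + 1) = k (j + 1) := l4 j
        rw [e4, Q3, el, hT]
    have hQ : ∀ j i, j < i + 3 → (Q j).coeff i = 0 := by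
      intro j i hj
      match j with
      | 0 => simp [Q0]
      | 1 => simp [Q1]
      | 2 => simp [Q2]
      | j + 3 => rw [Q3]; exact hl _ _ (by omega)
    intro n hn
    obtain ⟨m, rfl⟩ : ∃ m, n = m + 1 := ⟨n - 1, by omega⟩
    obtain ⟨d1, d2, d3, h⟩ := rel_expand T hadd hsmul s κ hrel Q (fun j => B (j - 3)) c l (m + 1)
      (fun i hi => hXQ i (by omega))
      (by
        cases m with
        | zero => simp [c3]
        | succ m => rw [hXQ (m + 1 + 1) (by omega)])
      (by
        cases m with
        | zero => simp [l3]
        | succ m => rw [hXQ (m + 1 + 1) (by omega)])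
      hTQ
    have h1 := congrArg (fun p => p.coeff (m + 2)) h
    have e4 : Q (m + 1 + 4) = P (m + 2) := Q3 (m + 2)
    simp only [coeff_add, coeff_C_mul, coeff_zero, e4, hs] at h1
    rw [hQ _ _ (by omega), hQ _ _ (by omega), hQ _ _ (by omega), hQ _ _ (by omega)] at h1
    have l1 : l (m + 1 + 3) = k (m + 1) := l4 m
    have l2 : l (m + 1 + 4) = k (m + 1 + 1) := l4 (m + 1)
    have l3 : l (m + 1 + 5) = k (m + 1 + 2) := l4 (m + 2)
    rw [l1, l2, l3] at h1
    linear_combination h1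
  · intro n hn
    obtain ⟨m, rfl⟩ : ∃ m, n = m + 1 := ⟨n - 1, by omega⟩
    obtain ⟨d1, d2, d3, h⟩ := rel_expand T hadd hsmul s κ hrel P B Co k m
      (fun i _ => hX i) (by rw [hX m]) (by rw [hX m]) hT
    generalize k (m + 3) - s * k (m + 4) + k (m + 5) + (s - 2) / 2 = d4 at h
    have peel : ∀ i : ℕ, ∀ p : ℂ[X], p = 0 → p.coeff i = 0 := by
      intro i p hp; rw [hp, coeff_zero]
    have z4 : d4 = 0 := by
      have := peel (m + 4) _ h
      simpa only [coeff_add, coeff_C_mul, hs, hl (m + 3) (m + 4) (by omega),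
        hl (m + 2) (m + 4) (by omega), hl (m + 1) (m + 4) (by omega),
        hl m (m + 4) (by omega), mul_zero, add_zero, mul_one] using this
    rw [z4, map_zero, zero_mul, zero_add] at h
    have z3 : d3 = 0 := by
      have := peel (m + 3) _ h
      simpa only [coeff_add, coeff_C_mul, hs,
        hl (m + 2) (m + 3) (by omega), hl (m + 1) (m + 3) (by omega),
        hl m (m + 3) (by omega), mul_zero, add_zero, mul_one] using this
    rw [z3, map_zero, zero_mul, zero_add] at h
    have z2 : d2 = 0 := by
      have := peel (m + 2) _ h
      simpa only [coeff_add, coeff_C_mul, hs, hl (m + 1) (m + 2) (by omega),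
        hl m (m + 2) (by omega), mul_zero, add_zero, mul_one] using this
    rw [z2, map_zero, zero_mul, zero_add] at h
    have z1 : d1 = 0 := by
      have := peel (m + 1) _ h
      simpa only [coeff_add, coeff_C_mul, hs,
        hl m (m + 1) (by omega), mul_zero, add_zero, mul_one] using this
    rw [z1, map_zero, zero_mul, zero_add] at h
    have := peel m _ h
    simp only [coeff_C_mul, hs, mul_one] at this
    exact this

/-- for a monic OPS with `𝒮_q(𝒟_q P_n) = k_n P_{n-1}`, setting
`t_n = k_n/C_n`, for all `n ≥ 1`:
`(k_{n+2} − 1/2) − 2(2α²−1)(k_{n+1} − 1/2) + (k_n − 1/2) = 0` and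
`t_{n+2} − 2(2α²−1)t_{n+1} + t_n = 0`. -/
theorem stmt_5 (q : ℝ) (hq0 : 0 < q) (hq1 : q < 1)
    (Dq Sq : ℂ[X] → ℂ[X]) (hD : IsAW q Dq) (hS : IsAv q Sq)
    (P : ℕ → ℂ[X]) (B Co : ℕ → ℂ) (hops : MonicOPS P B Co)
    (k : ℕ → ℂ) (hAp : AppellSD Sq Dq P k)
    (t : ℕ → ℂ) (ht : ∀ n : ℕ, 1 ≤ n → t n = k n / Co n) :
    ∀ n : ℕ, 1 ≤ n →
      (k (n + 2) - 1 / 2) - 2 * (2 * (alp q) ^ 2 - 1) * (k (n + 1) - 1 / 2) +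
        (k n - 1 / 2) = 0 ∧
      t (n + 2) - 2 * (2 * (alp q) ^ 2 - 1) * t (n + 1) + t n = 0 := by
  have hr : qh q ≠ 0 := by
    unfold qh; exact_mod_cast (Real.sqrt_pos.2 hq0).ne'
  have hr2 : qh q ^ 2 = (q : ℂ) := by
    unfold qh; exact_mod_cast Real.sq_sqrt hq0.le
  have hr1 : qh q ^ 2 ≠ 1 := by
    rw [hr2]; exact_mod_cast hq1.ne
  have hs : 2 * (2 * (alp q) ^ 2 - 1) = qh q ^ 2 + (qh q ^ 2)⁻¹ := by
    unfold alp; field_simp; ring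
  have core := appell_core (fun p => Sq (Dq p))
    (by
      intro p p'
      apply aw_inf q hq0 hq1
      intro w a1 a2 a3 a4
      obtain ⟨y, z, A, A', h, -⟩ := aw_T q hq0 hq1 Dq Sq hD hS w a1 a2 a3 a4 hr hr1
      simp only [eval_add, h]
      ring)
    (by
      intro a p
      apply aw_inf q hq0 hq1
      intro w a1 a2 a3 a4
      obtain ⟨y, z, A, A', h, -⟩ := aw_T q hq0 hq1 Dq Sq hD hS w a1 a2 a3 a4 hr hr1
      simp only [eval_mul, eval_C, h]
      ring)
    (qh q ^ 2 + (qh q ^ 2)⁻¹) (-(qh q ^ 2 - (qh q ^ 2)⁻¹) ^ 2 / 4)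
    (by
      intro p
      apply aw_inf q hq0 hq1
      intro w a1 a2 a3 a4
      obtain ⟨y, z, A, A', h, h1, h2, h3⟩ :=
        aw_T q hq0 hq1 Dq Sq hD hS w a1 a2 a3 a4 hr hr1
      simp only [eval_mul, eval_C, eval_add, eval_sub, eval_pow, eval_X, h]
      generalize (w + w⁻¹) / 2 = x at *
      linear_combination A * p.eval y * h1 + A' * p.eval z * h2 - p.eval x * h3)
    P B Co hops k hAp.1 hAp.2
  intro n hn
  rw [hs]
  refine ⟨by linear_combination core.1 n hn, ?_⟩
  rw [ht n hn, ht (n + 1) (by omega), ht (n + 2) (by omega)]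
  have c0 := hops.Cne n hn
  have c1 := hops.Cne (n + 1) (by omega)
  have c2 := hops.Cne (n + 2) (by omega)
  have h := core.2 n hn
  generalize qh q ^ 2 + (qh q ^ 2)⁻¹ = s at *
  field_simp
  linear_combination h
end

section
/- Let (P_n)_{n≥0} be a monic OPS with recurrence coefficients (B_n, C_n) satisfying 𝒮_q(𝒟_q P_n) = k_n P_{n−1} for all n ≥ 0, for some constants k_n ∈ ℂ. Set t_n = k_n/C_n for n ≥ 1. Then: (i) for all n ≥ 1, k_{n+1}B_{n+1} + (k_{n+1} − k_{n+2} − 2(2α²−1)k_n)B_n + k_n B_{n−1} = 0; (ii) for all n ≥ 1, t_{n+3}B_{n+2} − (t_{n+2} + t_{n+1})B_{n+1} + t_n B_n = 0; (iii) for all n ≥ 3, (t_{n+1} + t_{n+2})(C_{n+1} − 1/4) − 4α² t_n (C_n − 1/4) + (t_{n−1} + t_{n−2})(C_{n−1} − 1/4) = t_n [B_n² − 2(2α²−1)B_n B_{n−1} + B_{n−1}²]. -/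
open Polynomial

lemma poly_ext_w (q : ℝ) (hq0 : 0 < q) (F G : ℂ[X])
    (h : ∀ w : ℂ, w ≠ 0 → w ^ 2 ≠ 1 → (qh q * w) ^ 2 ≠ 1 → ((qh q)⁻¹ * w) ^ 2 ≠ 1 →
      F.eval ((w + w⁻¹) / 2) = G.eval ((w + w⁻¹) / 2)) : F = G := by
  have hs : 0 < Real.sqrt q := Real.sqrt_pos.mpr hq0
  set s := Real.sqrt q with hsdef
  set M : ℝ := max 1 (max s s⁻¹) with hM
  have hM1 : 1 ≤ M := le_max_left _ _
  have hMs : s ≤ M := le_trans (le_max_left _ _) (le_max_right _ _)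
  have hMs' : s⁻¹ ≤ M := le_trans (le_max_right _ _) (le_max_right _ _)
  refine Polynomial.eq_of_infinite_eval_eq F G ?_
  have hinj : Set.InjOn (fun r : ℝ => (((r : ℂ) + (r : ℂ)⁻¹) / 2)) (Set.Ioi M) := by
    intro x hx y hy hxy
    have hx' : M < x := hx
    have hy' : M < y := hy
    have hx0 : x ≠ 0 := by linarith
    have hy0 : y ≠ 0 := by linarith
    have h1 : (x + x⁻¹) / 2 = (y + y⁻¹) / 2 := by
      simp only at hxy
      exact_mod_cast hxy
    field_simp at h1
    have h2 : (x - y) * (x * y - 1) = 0 := by linarith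
    rcases mul_eq_zero.mp h2 with h3 | h3
    · linarith
    · nlinarith
  refine ((Set.Ioi_infinite M).image hinj).mono ?_
  rintro _ ⟨r, hr, rfl⟩
  have hr' : M < r := hr
  have hr0 : 0 < r := by linarith
  have key : ∀ y : ℝ, 1 < y → y ^ 2 ≠ 1 := fun y hy => by nlinarith
  simp only [Set.mem_setOf_eq]
  refine h r ?_ ?_ ?_ ?_
  · exact_mod_cast hr0.ne'
  · exact_mod_cast key r (by linarith)
  · have : 1 < s * r := by
      have : s * s⁻¹ < s * r := mul_lt_mul_of_pos_left (by linarith) hs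
      rwa [mul_inv_cancel₀ hs.ne'] at this
    unfold qh
    exact_mod_cast key _ this
  · have : 1 < s⁻¹ * r := by
      have : s⁻¹ * s < s⁻¹ * r := mul_lt_mul_of_pos_left (by linarith) (inv_pos.mpr hs)
      rwa [inv_mul_cancel₀ hs.ne'] at this
    unfold qh
    exact_mod_cast key _ this

lemma SD_eval (q : ℝ) (hq0 : 0 < q) (Dq Sq : ℂ[X] → ℂ[X]) (hD : IsAW q Dq) (hS : IsAv q Sq)
    (p : ℂ[X]) (w : ℂ) (hw : w ≠ 0) (hw1 : w ^ 2 ≠ 1) (hw2 : (qh q * w) ^ 2 ≠ 1)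
    (hw3 : ((qh q)⁻¹ * w) ^ 2 ≠ 1) :
    (Sq (Dq p)).eval ((w + w⁻¹) / 2) =
      ((p.eval (((qh q) ^ 2 * w + ((qh q) ^ 2)⁻¹ * w⁻¹) / 2) - p.eval ((w + w⁻¹) / 2)) /
        (((qh q - (qh q)⁻¹) / 2) * (qh q * w - (qh q)⁻¹ * w⁻¹)) +
      (p.eval ((w + w⁻¹) / 2) - p.eval ((((qh q) ^ 2)⁻¹ * w + (qh q) ^ 2 * w⁻¹) / 2)) /
        (((qh q - (qh q)⁻¹) / 2) * ((qh q)⁻¹ * w - qh q * w⁻¹))) / 2 := by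
  have hs : qh q ≠ 0 := by
    unfold qh
    exact_mod_cast (Real.sqrt_pos.mpr hq0).ne'
  rw [hS _ w hw hw1]
  have e1 := hD p (qh q * w) (mul_ne_zero hs hw) hw2
  have e2 := hD p ((qh q)⁻¹ * w) (mul_ne_zero (inv_ne_zero hs) hw) hw3
  have a1 : (qh q * w)⁻¹ = (qh q)⁻¹ * w⁻¹ := mul_inv _ _
  have a2 : ((qh q)⁻¹ * w)⁻¹ = qh q * w⁻¹ := by rw [mul_inv, inv_inv]
  rw [a1] at e1
  rw [a2] at e2
  rw [e1, e2]
  have b1 : qh q * (qh q * w) + (qh q)⁻¹ * ((qh q)⁻¹ * w⁻¹)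
    = (qh q) ^ 2 * w + ((qh q) ^ 2)⁻¹ * w⁻¹ := by field_simp
  have b2 : (qh q)⁻¹ * (qh q * w) + qh q * ((qh q)⁻¹ * w⁻¹) = w + w⁻¹ := by field_simp
  have b3 : qh q * ((qh q)⁻¹ * w) + (qh q)⁻¹ * (qh q * w⁻¹) = w + w⁻¹ := by field_simp
  have b4 : (qh q)⁻¹ * ((qh q)⁻¹ * w) + qh q * (qh q * w⁻¹)
    = ((qh q) ^ 2)⁻¹ * w + (qh q) ^ 2 * w⁻¹ := by field_simp
  rw [b1, b2, b3, b4]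

lemma SD_add (q : ℝ) (hq0 : 0 < q) (Dq Sq : ℂ[X] → ℂ[X]) (hD : IsAW q Dq) (hS : IsAv q Sq)
    (f g : ℂ[X]) : Sq (Dq (f + g)) = Sq (Dq f) + Sq (Dq g) := by
  refine poly_ext_w q hq0 _ _ fun w h0 h1 h2 h3 => ?_
  rw [eval_add]
  simp only [SD_eval q hq0 Dq Sq hD hS _ w h0 h1 h2 h3, eval_add]
  ring

lemma SD_smul (q : ℝ) (hq0 : 0 < q) (Dq Sq : ℂ[X] → ℂ[X]) (hD : IsAW q Dq) (hS : IsAv q Sq)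
    (c : ℂ) (f : ℂ[X]) : Sq (Dq (Polynomial.C c * f)) = Polynomial.C c * Sq (Dq f) := by
  refine poly_ext_w q hq0 _ _ fun w h0 h1 h2 h3 => ?_
  rw [eval_mul, eval_C]
  simp only [SD_eval q hq0 Dq Sq hD hS _ w h0 h1 h2 h3, eval_mul, eval_C]
  ring

lemma SD_key (q : ℝ) (hq0 : 0 < q) (hq1 : q < 1) (Dq Sq : ℂ[X] → ℂ[X]) (hD : IsAW q Dq)
    (hS : IsAv q Sq) (a : ℂ) (ha : a = 2 * (alp q) ^ 2 - 1) (f : ℂ[X]) :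
    Sq (Dq (X * (X * f))) - Polynomial.C (2 * a) * (X * Sq (Dq (X * f)))
      + (X * (X * Sq (Dq f))) + Polynomial.C (a ^ 2 - 1) * Sq (Dq f)
      = Polynomial.C (1 - a) * (X * f) := by
  refine poly_ext_w q hq0 _ _ fun w h0 h1 h2 h3 => ?_
  have hs : qh q ≠ 0 := by
    unfold qh
    exact_mod_cast (Real.sqrt_pos.mpr hq0).ne'
  have hs2 : (qh q) ^ 2 = (q : ℂ) := by
    unfold qh
    exact_mod_cast Real.sq_sqrt hq0.le
  have hs1 : (qh q) ^ 2 - 1 ≠ 0 := by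
    rw [hs2, sub_ne_zero]
    exact_mod_cast hq1.ne
  have hw2 : (qh q) ^ 2 * w ^ 2 - 1 ≠ 0 := by
    rw [sub_ne_zero, ← mul_pow]; exact h2
  have hw3 : w ^ 2 - (qh q) ^ 2 ≠ 0 := by
    intro h
    apply h3
    rw [mul_pow, inv_pow, sub_eq_zero.mp h]
    field_simp
  simp only [eval_add, eval_sub, eval_mul, eval_C, eval_X,
    SD_eval q hq0 Dq Sq hD hS _ w h0 h1 h2 h3]
  generalize f.eval (((qh q) ^ 2 * w + ((qh q) ^ 2)⁻¹ * w⁻¹) / 2) = fp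
  generalize f.eval ((((qh q) ^ 2)⁻¹ * w + (qh q) ^ 2 * w⁻¹) / 2) = fm
  generalize f.eval ((w + w⁻¹) / 2) = f0
  subst ha
  unfold alp
  generalize qh q = s at *
  have d1 : (s - s⁻¹) / 2 * (s * w - s⁻¹ * w⁻¹) = (s ^ 2 - 1) * (s ^ 2 * w ^ 2 - 1) / (2 * s ^ 2 * w) := by
    field_simp
  have d2 : (s - s⁻¹) / 2 * (s⁻¹ * w - s * w⁻¹) = (s ^ 2 - 1) * (w ^ 2 - s ^ 2) / (2 * s ^ 2 * w) := by
    field_simp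
  rw [d1, d2]
  field_simp
  ring

lemma lin_indep {P : ℕ → ℂ[X]} {B Co : ℕ → ℂ} (hops : MonicOPS P B Co) (n : ℕ)
    (a0 a1 a2 a3 a4 : ℂ)
    (h : C a4 * P (n + 4) + C a3 * P (n + 3) + C a2 * P (n + 2) + C a1 * P (n + 1)
      + C a0 * P n = 0) : a4 = 0 ∧ a3 = 0 ∧ a2 = 0 ∧ a1 = 0 ∧ a0 = 0 := by
  have top : ∀ m, (P m).coeff m = 1 := fun m => by
    have := hops.monic m
    rw [Monic, leadingCoeff, hops.deg] at this
    exact this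
  have low : ∀ m j, m < j → (P m).coeff j = 0 := fun m j hj =>
    coeff_eq_zero_of_natDegree_lt (by rw [hops.deg]; exact hj)
  have co : ∀ j, a4 * (P (n+4)).coeff j + a3 * (P (n+3)).coeff j + a2 * (P (n+2)).coeff j
      + a1 * (P (n+1)).coeff j + a0 * (P n).coeff j = 0 := fun j => by
    have := congrArg (fun p => coeff p j) h
    simpa using this
  have h4 : a4 = 0 := by
    have := co (n+4)
    rw [top, low (n+3) _ (by omega), low (n+2) _ (by omega), low (n+1) _ (by omega),
      low n _ (by omega)] at this
    simpa using this
  subst h4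
  have h4 : a3 = 0 := by
    have := co (n+3)
    rw [top, low (n+2) _ (by omega), low (n+1) _ (by omega), low n _ (by omega)] at this
    simpa using this
  subst h4
  have h4 : a2 = 0 := by
    have := co (n+2)
    rw [top, low (n+1) _ (by omega), low n _ (by omega)] at this
    simpa using this
  subst h4
  have h4 : a1 = 0 := by
    have := co (n+1)
    rw [top, low n _ (by omega)] at this
    simpa using this
  subst h4
  have h4 : a0 = 0 := by
    have := co n
    rw [top] at this
    simpa using this
  exact ⟨rfl, rfl, rfl, rfl, h4⟩

/-- for a monic OPS with `𝒮_q(𝒟_q P_n) = k_n P_{n-1}`, setting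
`t_n = k_n/C_n`, the stated three difference equations for `B_n` and `C_n` hold. -/
theorem stmt_6 (q : ℝ) (hq0 : 0 < q) (hq1 : q < 1)
    (Dq Sq : ℂ[X] → ℂ[X]) (hD : IsAW q Dq) (hS : IsAv q Sq)
    (P : ℕ → ℂ[X]) (B Co : ℕ → ℂ) (hops : MonicOPS P B Co)
    (k : ℕ → ℂ) (hAp : AppellSD Sq Dq P k)
    (t : ℕ → ℂ) (ht : ∀ n : ℕ, 1 ≤ n → t n = k n / Co n) :
    (∀ n : ℕ, 1 ≤ n →
      k (n + 1) * B (n + 1) +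
        (k (n + 1) - k (n + 2) - 2 * (2 * (alp q) ^ 2 - 1) * k n) * B n +
        k n * B (n - 1) = 0) ∧
    (∀ n : ℕ, 1 ≤ n →
      t (n + 3) * B (n + 2) - (t (n + 2) + t (n + 1)) * B (n + 1) + t n * B n = 0) ∧
    (∀ n : ℕ, 3 ≤ n →
      (t (n + 1) + t (n + 2)) * (Co (n + 1) - 1 / 4) -
        4 * (alp q) ^ 2 * t n * (Co n - 1 / 4) +
        (t (n - 1) + t (n - 2)) * (Co (n - 1) - 1 / 4) =
      t n * (B n ^ 2 - 2 * (2 * (alp q) ^ 2 - 1) * B n * B (n - 1) + B (n - 1) ^ 2)) := by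
  obtain ⟨hA0, hA⟩ := hAp
  obtain ⟨a, ha⟩ : ∃ a : ℂ, a = 2 * (alp q) ^ 2 - 1 := ⟨_, rfl⟩
  have Ladd := SD_add q hq0 Dq Sq hD hS
  have Lsm := SD_smul q hq0 Dq Sq hD hS
  have key := SD_key q hq0 hq1 Dq Sq hD hS a ha
  have x0 : X * P 0 = P 1 + C (B 0) * P 0 := by rw [hops.p0, hops.p1]; ring
  have xs : ∀ n, X * P (n + 1) = P (n + 2) + C (B (n + 1)) * P (n + 1) + C (Co (n + 1)) * P n :=
    fun n => by rw [hops.ttrr n]; ring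
  -- coefficient identities
  have main3 : ∀ n : ℕ,
      k (n+5) - 2 * a * k (n+4) + k (n+3) - (1 - a) = 0 ∧
      (B (n+4) + B (n+3)) * k (n+4) - 2 * a * (k (n+4) * B (n+3) + B (n+3) * k (n+3))
        + k (n+3) * (B (n+3) + B (n+2)) - (1 - a) * B (n+3) = 0 ∧
      (Co (n+4) + B (n+3) ^ 2 + Co (n+3)) * k (n+3)
        - 2 * a * (k (n+4) * Co (n+3) + k (n+3) * B (n+3) * B (n+2) + Co (n+3) * k (n+2))
        + k (n+3) * (Co (n+3) + B (n+2) ^ 2 + Co (n+2) + a ^ 2 - 1) - (1 - a) * Co (n+3) = 0 ∧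
      Co (n+3) * (B (n+3) + B (n+2)) * k (n+2)
        - 2 * a * (k (n+3) * B (n+3) * Co (n+2) + Co (n+3) * k (n+2) * B (n+1))
        + k (n+3) * Co (n+2) * (B (n+2) + B (n+1)) = 0 ∧
      Co (n+3) * Co (n+2) * k (n+1) - 2 * a * Co (n+3) * k (n+2) * Co (n+1)
        + k (n+3) * Co (n+2) * Co (n+1) = 0 := by
    intro n
    apply lin_indep hops n
    have h := key (P (n + 3))
    simp only [xs (n+2), xs (n+1), xs n, xs (n+3), Ladd, Lsm, mul_add, hA, mul_left_comm X (C _)] at h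
    simp only [map_add, map_sub, map_mul, map_pow, map_one, map_ofNat] at h ⊢
    linear_combination h
  have main2 : 
      k 4 - 2 * a * k 3 + k 2 - (1 - a) = 0 ∧
      (B 3 + B 2) * k 3 - 2 * a * (k 3 * B 2 + B 2 * k 2)
        + k 2 * (B 2 + B 1) - (1 - a) * B 2 = 0 := by
    have := lin_indep hops 0 
      (Co 2 * (B 2 + B 1) * k 1
        - 2 * a * (k 2 * B 2 * Co 1 + Co 2 * k 1 * B 0)
        + k 2 * Co 1 * (B 1 + B 0)) 
      ((Co 3 + B 2 ^ 2 + Co 2) * k 2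
        - 2 * a * (k 3 * Co 2 + k 2 * B 2 * B 1 + Co 2 * k 1)
        + k 2 * (Co 2 + B 1 ^ 2 + Co 1 + a ^ 2 - 1) - (1 - a) * Co 2)
      ((B 3 + B 2) * k 3 - 2 * a * (k 3 * B 2 + B 2 * k 2)
        + k 2 * (B 2 + B 1) - (1 - a) * B 2) 
      (k 4 - 2 * a * k 3 + k 2 - (1 - a)) 0 ?_
    · exact ⟨this.2.1, this.2.2.1⟩
    have h := key (P 2)
    have x1 := xs 0
    have x2 := xs 1
    have x3 := xs 2
    have A0 := hA 0
    have A1 := hA 1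
    have A2 := hA 2
    have A3 := hA 3
    norm_num only at x1 x2 x3 A0 A1 A2 A3
    simp only [x0, x1, x2, x3, Ladd, Lsm, mul_add, A0, A1, A2, A3, hA0, mul_left_comm X (C _)] at h
    simp only [map_add, map_sub, map_mul, map_pow, map_one, map_ofNat, map_zero, zero_add] at h ⊢
    linear_combination h
  have main1 : 
      k 3 - 2 * a * k 2 + k 1 - (1 - a) = 0 ∧
      (B 2 + B 1) * k 2 - 2 * a * (k 2 * B 1 + B 1 * k 1)
        + k 1 * (B 1 + B 0) - (1 - a) * B 1 = 0 := by
    have := lin_indep hops 0 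
      ((Co 2 + B 1 ^ 2 + Co 1) * k 1
        - 2 * a * (k 2 * Co 1 + k 1 * B 1 * B 0)
        + k 1 * (Co 1 + B 0 ^ 2 + a ^ 2 - 1) - (1 - a) * Co 1)
      ((B 2 + B 1) * k 2 - 2 * a * (k 2 * B 1 + B 1 * k 1)
        + k 1 * (B 1 + B 0) - (1 - a) * B 1) 
      (k 3 - 2 * a * k 2 + k 1 - (1 - a)) 0 0 ?_
    · exact ⟨this.2.2.1, this.2.2.2.1⟩
    have h := key (P 1)
    have x1 := xs 0
    have x2 := xs 1
    have A0 := hA 0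
    have A1 := hA 1
    have A2 := hA 2
    norm_num only at x1 x2 A0 A1 A2
    simp only [x0, x1, x2, Ladd, Lsm, mul_add, A0, A1, A2, hA0, mul_left_comm X (C _)] at h
    simp only [map_add, map_sub, map_mul, map_pow, map_one, map_ofNat, map_zero, zero_add] at h ⊢
    linear_combination h
  have hk : ∀ n, k (n+1) = t (n+1) * Co (n+1) := fun n => by
    rw [ht _ (by omega), div_mul_cancel₀ _ (hops.Cne _ (by omega))]
  have tr : ∀ n, t (n+1) - 2 * a * t (n+2) + t (n+3) = 0 := by
    intro n
    have h := (main3 n).2.2.2.2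
    rw [hk n, hk (n+1), hk (n+2)] at h
    have hc : Co (n+3) * Co (n+2) * Co (n+1) ≠ 0 :=
      mul_ne_zero (mul_ne_zero (hops.Cne _ (by omega)) (hops.Cne _ (by omega)))
        (hops.Cne _ (by omega))
    apply mul_left_cancel₀ hc
    linear_combination h
  have kr : ∀ n, k (n+3) - 2 * a * k (n+2) + k (n+1) - (1 - a) = 0 := by
    intro n
    match n with
    | 0 => exact main1.1
    | 1 => exact main2.1
    | n+2 => exact (main3 n).1
  have hb : ∀ n, (B (n+2) + B (n+1)) * k (n+2) - 2 * a * (k (n+2) * B (n+1) + B (n+1) * k (n+1))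
        + k (n+1) * (B (n+1) + B n) - (1 - a) * B (n+1) = 0 := by
    intro n
    match n with
    | 0 => exact main1.2
    | 1 => exact main2.2
    | n+2 => exact (main3 n).2.1
  rw [← ha]
  refine ⟨?_, ?_, ?_⟩
  · intro n hn
    obtain ⟨m, rfl⟩ := Nat.exists_eq_add_of_le' hn
    simp only [Nat.add_sub_cancel]
    have h1 := hb m
    have h2 := kr m
    linear_combination h1 - B (m+1) * h2
  · intro n hn
    obtain ⟨m, rfl⟩ := Nat.exists_eq_add_of_le' hn
    have h := (main3 m).2.2.2.1
    rw [hk (m+1), hk (m+2)] at h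
    have hc : Co (m+3) * Co (m+2) ≠ 0 :=
      mul_ne_zero (hops.Cne _ (by omega)) (hops.Cne _ (by omega))
    have h1 := tr m
    have h2 := tr (m+1)
    apply mul_left_cancel₀ hc
    linear_combination (-1 : ℂ) * h + Co (m+3) * Co (m+2) * (B (m+1) * h1 + B (m+3) * h2)
  · intro n hn
    obtain ⟨m, rfl⟩ := Nat.exists_eq_add_of_le' hn
    have e1 : m + 3 - 1 = m + 2 := rfl
    have e2 : m + 3 - 2 = m + 1 := rfl
    rw [e1, e2]
    have ha4 : 4 * (alp q) ^ 2 = 2 * (a + 1) := by rw [ha]; ring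
    rw [ha4]
    have h := (main3 m).2.2.1
    have h0 := kr (m+1)
    have h1 := tr m
    have h2 := tr (m+1)
    have h3 := tr (m+2)
    rw [hk (m+1), hk (m+2), hk (m+3)] at h h0
    apply mul_left_cancel₀ (hops.Cne (m+3) (by omega))
    linear_combination (-1 : ℂ) * h + Co (m+3) * (h0 + (Co (m+2) - 1/4) * h1 + (Co (m+4) - 1/4) * h3 - (1/4 + a/2) * h2)
end

section
/- A monic OPS (P_n)_{n≥0} with recurrence coefficients (B_n, C_n) satisfies 𝒮_q(𝒟_q P_n) = k_n P_{n−1} for all n ≥ 0, for some constants k_n ∈ ℂ, if and only if B_n = 0 for all n ≥ 0 and there exists s ∈ {1, −1} such that C_n = (1/4)(1 − q^{sn})(1 + q^{s(n−1)}) for all n ≥ 1. In this case k_n = γ_n·α_{n−1} for all n ≥ 1 (and k_0 = 0); that is, (P_n) is the monic Al-Salam–Chihara polynomial sequence Q_n(z; s, −s | q^s). -/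
open Polynomial

/-- The abstract properties of `T = 𝒮_q 𝒟_q` that are used. -/
structure TProp (q : ℂ) (T : ℂ[X] → ℂ[X]) : Prop where
  tadd : ∀ p r, T (p + r) = T p + T r
  smul : ∀ (a : ℂ) p, T (C a * p) = C a * T p
  one : T 1 = 0
  tX : T X = 1
  star : ∀ f, T (X ^ 2 * f) - C (q + 1 / q) * X * T (X * f) +
    X ^ 2 * T f + C ((q - 1 / q) ^ 2 / 4) * T f =
      C (1 - (q + 1 / q) / 2) * X * f

theorem T_step {q : ℂ} {T : ℂ[X] → ℂ[X]} (hT : TProp q T)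
    (p2 p1 p0 pm1 pm2 pm3 : ℂ[X])
    (k1 k0 km kmm B1 B0 Bm Bmm C1 C0 Cm Cmm : ℂ)
    (h1 : X * p1 = p2 + C B1 * p1 + C C1 * p0)
    (h0 : X * p0 = p1 + C B0 * p0 + C C0 * pm1)
    (hm : C C0 * (X * pm1) = C C0 * (p0 + C Bm * pm1 + C Cm * pm2))
    (hm' : C k0 * (X * pm1) = C k0 * (p0 + C Bm * pm1 + C Cm * pm2))
    (hmm : C (C0 * km) * (X * pm2) = C (C0 * km) * (pm1 + C Bmm * pm2 + C Cmm * pm3))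
    (hmm' : C (Cm * k0) * (X * pm2) = C (Cm * k0) * (pm1 + C Bmm * pm2 + C Cmm * pm3))
    (t1 : T p1 = C k1 * p0) (t0 : T p0 = C k0 * pm1)
    (tm : C C0 * T pm1 = C C0 * (C km * pm2))
    (tmm : C (C0 * Cm) * T pm2 = C (C0 * Cm) * (C kmm * pm3)) :
    T p2 = C ((q + 1 / q) * k1 - k0 + (1 - (q + 1 / q) / 2)) * p1
      + C (-(B1 + B0) * k1 + (q + 1 / q) * B0 * (k1 + k0) - k0 * (B0 + Bm)
          + (1 - (q + 1 / q) / 2) * B0) * p0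
      + C (-(C1 + C0 + B0 ^ 2) * k0 + (q + 1 / q) * (k1 * C0 + B0 * k0 * Bm + C0 * km)
          - k0 * (C0 + Cm + Bm ^ 2) - (q - 1 / q) ^ 2 / 4 * k0
          + (1 - (q + 1 / q) / 2) * C0) * pm1
      + C (-C0 * (B0 + Bm) * km + (q + 1 / q) * (B0 * k0 * Cm + C0 * km * Bmm)
          - k0 * Cm * (Bm + Bmm)) * pm2
      + C (-C0 * Cm * kmm + (q + 1 / q) * C0 * km * Cmm - k0 * Cm * Cmm) * pm3 := by
  have e2 : X ^ 2 * p0 = p2 + C (B1 + B0) * p1 + C (C1 + C0 + B0 ^ 2) * p0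
      + C (B0 + Bm) * (C C0 * pm1) + C (C0 * Cm) * pm2 := by
    simp only [C_add, C_mul, C_pow]
    linear_combination (X + C B0) * h0 + h1 + hm
  have hC : ∀ (a : ℂ) p, C a * T p = T (C a * p) := fun a p => (hT.smul a p).symm
  have T2 : T (X ^ 2 * p0) = T p2 + C (B1 + B0) * (C k1 * p0)
      + C (C1 + C0 + B0 ^ 2) * (C k0 * pm1)
      + C (B0 + Bm) * (C C0 * (C km * pm2)) + C (C0 * Cm) * (C kmm * pm3) := by
    rw [e2]
    simp only [hT.tadd, hT.smul]
    rw [tm, tmm, t1, t0]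
  have T1 : T (X * p0) = C k1 * p0 + C B0 * (C k0 * pm1) + C C0 * (C km * pm2) := by
    rw [h0]
    simp only [hT.tadd, hT.smul]
    rw [tm, t1, t0]
  have st := hT.star p0
  rw [T2, T1, t0] at st
  generalize hA : q + 1 / q = A at *
  generalize hb : (q - 1 / q) ^ 2 / 4 = b at *
  generalize hg : 1 - A / 2 = g at *
  simp only [C_add, C_mul, C_pow, C_neg, C_sub] at *
  linear_combination st + (C A * C k1 + C g) * h0 + C A * C B0 * hm' + C A * hmm
    - (X + C Bm) * hm' - hmm' - C k0 * h0

theorem lin5 {P : ℕ → ℂ[X]} (hm : ∀ n, (P n).Monic) (hd : ∀ n, (P n).natDegree = n)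
    (m : ℕ) (a b c d e : ℂ)
    (h : C a * P (m + 4) + C b * P (m + 3) + C c * P (m + 2) + C d * P (m + 1) + C e * P m = 0) :
    a = 0 ∧ b = 0 ∧ c = 0 ∧ d = 0 ∧ e = 0 := by
  have hs : ∀ n, (P n).coeff n = 1 := fun n => by
    have := hm n
    rw [Monic, leadingCoeff, hd] at this
    exact this
  have hz : ∀ n j, n < j → (P n).coeff j = 0 := fun n j hj =>
    coeff_eq_zero_of_natDegree_lt (by rw [hd]; exact hj)
  have ha : a = 0 := by
    have := congrArg (fun p => coeff p (m + 4)) h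
    simpa [hs, hz] using this
  subst ha
  have hb : b = 0 := by
    have := congrArg (fun p => coeff p (m + 3)) h
    simpa [hs, hz] using this
  subst hb
  have hc : c = 0 := by
    have := congrArg (fun p => coeff p (m + 2)) h
    simpa [hs, hz] using this
  subst hc
  have hd' : d = 0 := by
    have := congrArg (fun p => coeff p (m + 1)) h
    simpa [hs, hz] using this
  subst hd'
  have he : e = 0 := by
    have := congrArg (fun p => coeff p m) h
    simpa [hs, hz] using this
  simp [he]

theorem poly_ext {u : ℝ} (hu0 : 0 < u) (hu1 : u < 1) (p r : ℂ[X])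
    (h : ∀ t : ℝ, 1 / u < t → p.eval (((t : ℂ) + (t : ℂ)⁻¹) / 2) = r.eval (((t : ℂ) + (t : ℂ)⁻¹) / 2)) :
    p = r := by
  apply Polynomial.eq_of_infinite_eval_eq
  have h1u : 1 < 1 / u := by rw [lt_div_iff₀ hu0]; linarith
  have hinj : Set.InjOn (fun t : ℝ => ((t : ℂ) + (t : ℂ)⁻¹) / 2) (Set.Ioi (1 / u)) := by
    intro t ht s hs hts
    simp only [Set.mem_Ioi] at ht hs
    have h2 : t + t⁻¹ = s + s⁻¹ := by
      have : (((t + t⁻¹ : ℝ)) : ℂ) = ((s + s⁻¹ : ℝ) : ℂ) := by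
        push_cast
        have h3 : ((t : ℂ) + (t : ℂ)⁻¹) / 2 = ((s : ℂ) + (s : ℂ)⁻¹) / 2 := hts
        linear_combination 2 * h3
      exact_mod_cast this
    have t1 : 1 < t := by linarith
    have s1 : 1 < s := by linarith
    have t0 : t ≠ 0 := by positivity
    have s0 : s ≠ 0 := by positivity
    field_simp at h2
    have h4 : (t - s) * (t * s - 1) = 0 := by linear_combination h2
    rcases mul_eq_zero.1 h4 with h5 | h5
    · linarith
    · nlinarith
  refine ((Set.Ioi_infinite (1 / u)).image hinj).mono ?_
  rintro _ ⟨t, ht, rfl⟩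
  exact h t ht

theorem TProp_of {q : ℝ} (hq0 : 0 < q) (hq1 : q < 1)
    {Dq Sq : ℂ[X] → ℂ[X]} (hD : IsAW q Dq) (hS : IsAv q Sq) :
    TProp (q : ℂ) (fun p => Sq (Dq p)) := by
  obtain ⟨u, hu⟩ : ∃ u, u = Real.sqrt q := ⟨_, rfl⟩
  have hu0 : 0 < u := by rw [hu]; exact Real.sqrt_pos.2 hq0
  have hu2 : u ^ 2 = q := by rw [hu]; exact Real.sq_sqrt hq0.le
  have hu1 : u < 1 := by nlinarith
  have hqh : qh q = (u : ℂ) := by rw [qh, hu]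
  have hqC : (q : ℂ) = (u : ℂ) ^ 2 := by rw [← hu2]; push_cast; rfl
  have huC : (u : ℂ) ≠ 0 := by exact_mod_cast hu0.ne'
  have hu21 : (u : ℂ) ^ 2 - 1 ≠ 0 := by
    have : u ^ 2 - 1 ≠ 0 := by nlinarith
    exact_mod_cast this
  have side : ∀ t : ℝ, 1 / u < t → (t : ℂ) ≠ 0 ∧ (u : ℂ) ^ 2 * t ^ 2 - 1 ≠ 0 ∧
      (t : ℂ) ^ 2 - u ^ 2 ≠ 0 ∧ (t : ℂ) ^ 2 - 1 ≠ 0 := by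
    intro t ht
    have h1u : 1 < 1 / u := by rw [lt_div_iff₀ hu0]; linarith
    rw [div_lt_iff₀ hu0] at ht
    have ht1 : 1 < t := by nlinarith
    refine ⟨by exact_mod_cast (by positivity : t ≠ 0), ?_, ?_, ?_⟩
    · have : u ^ 2 * t ^ 2 - 1 ≠ 0 := by nlinarith
      exact_mod_cast this
    · have : t ^ 2 - u ^ 2 ≠ 0 := by nlinarith
      exact_mod_cast this
    · have : t ^ 2 - 1 ≠ 0 := by nlinarith
      exact_mod_cast this
  have key : ∀ (p : ℂ[X]) (t : ℝ), 1 / u < t →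
      (Sq (Dq p)).eval (((t : ℂ) + (t : ℂ)⁻¹) / 2) =
      (u ^ 2 * t / ((u ^ 2 - 1) * (u ^ 2 * t ^ 2 - 1))) *
        (p.eval (((u : ℂ) ^ 2 * t + (u ^ 2 * t : ℂ)⁻¹) / 2) - p.eval (((t : ℂ) + (t : ℂ)⁻¹) / 2))
      + (u ^ 2 * t / ((u ^ 2 - 1) * (t ^ 2 - u ^ 2))) *
        (p.eval (((t : ℂ) + (t : ℂ)⁻¹) / 2) - p.eval (((t : ℂ) / u ^ 2 + (t / u ^ 2 : ℂ)⁻¹) / 2)) := by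
    intro p t ht
    obtain ⟨ht0, h1, h2, h3⟩ := side t ht
    rw [hS (Dq p) t ht0 (fun h => h3 (by rw [h]; ring)), hqh]
    have e1 : (u : ℂ) * t + (u : ℂ)⁻¹ * (t : ℂ)⁻¹ = (u * t : ℂ) + (u * t : ℂ)⁻¹ := by
      rw [mul_inv]
    have e2 : (u : ℂ)⁻¹ * t + (u : ℂ) * (t : ℂ)⁻¹ = ((u : ℂ)⁻¹ * t : ℂ) + ((u : ℂ)⁻¹ * t : ℂ)⁻¹ := by
      rw [mul_inv, inv_inv]
    rw [e1, e2]
    rw [hD p (u * t) (mul_ne_zero huC ht0) (fun h => h1 (by linear_combination h)),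
      hD p ((u : ℂ)⁻¹ * t) (mul_ne_zero (inv_ne_zero huC) ht0)
        (fun h => h2 (by field_simp at h; linear_combination h)), hqh]
    have a1 : (u : ℂ) * (u * t) + (u : ℂ)⁻¹ * (u * t : ℂ)⁻¹ = u ^ 2 * t + (u ^ 2 * t : ℂ)⁻¹ := by
      field_simp
    have a2 : (u : ℂ)⁻¹ * (u * t) + u * (u * t : ℂ)⁻¹ = t + (t : ℂ)⁻¹ := by
      field_simp
    have a3 : (u : ℂ) * ((u : ℂ)⁻¹ * t) + (u : ℂ)⁻¹ * ((u : ℂ)⁻¹ * t : ℂ)⁻¹ = t + (t : ℂ)⁻¹ := by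
      field_simp
    have a4 : (u : ℂ)⁻¹ * ((u : ℂ)⁻¹ * t) + u * ((u : ℂ)⁻¹ * t : ℂ)⁻¹ = t / u ^ 2 + (t / u ^ 2 : ℂ)⁻¹ := by
      field_simp
    rw [a1, a2, a3, a4]
    generalize p.eval (((u : ℂ) ^ 2 * t + (u ^ 2 * t : ℂ)⁻¹) / 2) = x
    generalize p.eval (((t : ℂ) + (t : ℂ)⁻¹) / 2) = y
    generalize p.eval (((t : ℂ) / u ^ 2 + (t / u ^ 2 : ℂ)⁻¹) / 2) = z
    have d1 : ((u : ℂ) - (u : ℂ)⁻¹) / 2 * (u * t - (u * t : ℂ)⁻¹)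
        = (u ^ 2 - 1) * (u ^ 2 * t ^ 2 - 1) / (2 * u ^ 2 * t) := by
      field_simp
    have d2 : ((u : ℂ) - (u : ℂ)⁻¹) / 2 * ((u : ℂ)⁻¹ * t - ((u : ℂ)⁻¹ * t : ℂ)⁻¹)
        = (u ^ 2 - 1) * (t ^ 2 - u ^ 2) / (2 * u ^ 2 * t) := by
      field_simp
    rw [d1, d2]
    field_simp
  refine ⟨?_, ?_, ?_, ?_, ?_⟩
  · intro p r
    refine poly_ext hu0 hu1 _ _ fun t ht => ?_
    simp only [eval_add, key _ t ht]
    ring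
  · intro a p
    refine poly_ext hu0 hu1 _ _ fun t ht => ?_
    simp only [eval_mul, eval_C, key _ t ht]
    ring
  · refine poly_ext hu0 hu1 _ _ fun t ht => ?_
    simp [key _ t ht]
  · refine poly_ext hu0 hu1 _ _ fun t ht => ?_
    obtain ⟨ht0, h1, h2, h3⟩ := side t ht
    simp only [key _ t ht, eval_X, eval_one]
    field_simp
    ring
  · intro f
    refine poly_ext hu0 hu1 _ _ fun t ht => ?_
    obtain ⟨ht0, h1, h2, h3⟩ := side t ht
    simp only [eval_add, eval_sub, eval_mul, eval_pow, eval_C, eval_X, key _ t ht]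
    generalize f.eval (((u : ℂ) ^ 2 * t + (u ^ 2 * t : ℂ)⁻¹) / 2) = x
    generalize f.eval (((t : ℂ) + (t : ℂ)⁻¹) / 2) = y
    generalize f.eval (((t : ℂ) / u ^ 2 + (t / u ^ 2 : ℂ)⁻¹) / 2) = z
    rw [hqC]
    field_simp
    ring

theorem appell_eqs {q : ℂ} {T : ℂ[X] → ℂ[X]} (hT : TProp q T)
    {P : ℕ → ℂ[X]} {B Co k : ℕ → ℂ} (h : MonicOPS P B Co) (hC0 : Co 0 = 0) (hk0 : k 0 = 0)
    (ha0 : T (P 0) = 0) (ha : ∀ n, T (P (n + 1)) = C (k (n + 1)) * P n) :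
    (∀ n, k (n + 2) = (q + 1 / q) * k (n + 1) - k n + (1 - (q + 1 / q) / 2)) ∧
    (-(B 1 + B 0) * k 1 + (q + 1 / q) * B 0 * k 1 + (1 - (q + 1 / q) / 2) * B 0 = 0) ∧
    (∀ n, -(B (n + 2) + B (n + 1)) * k (n + 2) + (q + 1 / q) * B (n + 1) * (k (n + 2) + k (n + 1))
      - k (n + 1) * (B (n + 1) + B n) + (1 - (q + 1 / q) / 2) * B (n + 1) = 0) ∧
    (∀ n, -(Co (n + 2) + Co (n + 1) + B (n + 1) ^ 2) * k (n + 1)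
      + (q + 1 / q) * (k (n + 2) * Co (n + 1) + B (n + 1) * k (n + 1) * B n + Co (n + 1) * k n)
          - k (n + 1) * (Co (n + 1) + Co n + B n ^ 2) - (q - 1 / q) ^ 2 / 4 * k (n + 1)
          + (1 - (q + 1 / q) / 2) * Co (n + 1) = 0) ∧
    (-Co 2 * (B 2 + B 1) * k 1 + (q + 1 / q) * (B 2 * k 2 * Co 1 + Co 2 * k 1 * B 0)
          - k 2 * Co 1 * (B 1 + B 0) = 0) ∧
    (-Co 3 * Co 2 * k 1 + (q + 1 / q) * Co 3 * k 2 * Co 1 - k 3 * Co 2 * Co 1 = 0) := by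
  have r : ∀ n, X * P (n + 1) = P (n + 2) + C (B (n + 1)) * P (n + 1) + C (Co (n + 1)) * P n := by
    intro n
    rw [h.ttrr n]; ring
  have r0 : X * P 0 = P 1 + C (B 0) * P 0 := by
    rw [h.p1, h.p0]; ring
  have T0 : T 0 = 0 := by simpa using hT.smul 0 0
  have s0 := T_step hT (P 2) (P 1) (P 0) 0 0 0 (k 1) 0 0 0 (B 1) (B 0) 0 0 (Co 1) 0 0 0
    (r 0) (by rw [r0]; simp) (by simp) (by simp) (by simp) (by simp) (ha 0) (by simp [ha0])
    (by simp) (by simp)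
  have s1 := T_step hT (P 3) (P 2) (P 1) (P 0) 0 0 (k 2) (k 1) 0 0 (B 2) (B 1) (B 0) 0
    (Co 2) (Co 1) 0 0
    (r 1) (r 0) (by rw [r0]; simp) (by rw [r0]; simp) (by simp) (by simp) (ha 1) (ha 0)
    (by simp [ha0]) (by simp)
  have s2 := T_step hT (P 4) (P 3) (P 2) (P 1) (P 0) 0 (k 3) (k 2) (k 1) 0 (B 3) (B 2) (B 1) (B 0)
    (Co 3) (Co 2) (Co 1) 0
    (r 2) (r 1) (by rw [r 0]) (by rw [r 0]) (by rw [r0]; simp) (by rw [r0]; simp) (ha 2) (ha 1)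
    (by rw [ha 0]) (by simp [ha0])
  have s3 := fun m => T_step hT (P (m + 5)) (P (m + 4)) (P (m + 3)) (P (m + 2)) (P (m + 1)) (P m)
    (k (m + 4)) (k (m + 3)) (k (m + 2)) (k (m + 1)) (B (m + 4)) (B (m + 3)) (B (m + 2)) (B (m + 1))
    (Co (m + 4)) (Co (m + 3)) (Co (m + 2)) (Co (m + 1))
    (r (m + 3)) (r (m + 2)) (by rw [r (m + 1)]) (by rw [r (m + 1)]) (by rw [r m]) (by rw [r m])
    (ha (m + 3)) (ha (m + 2)) (by rw [ha (m + 1)]) (by rw [ha m])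
  have l0 := lin5 h.monic h.deg 0 0 0 0 _ _ (by
    rw [ha 1] at s0
    simp only [mul_zero, add_zero] at s0
    rw [← sub_eq_zero, ← sub_sub, ← sub_mul, ← C_sub, sub_eq_add_neg, ← neg_mul, ← C_neg] at s0
    simpa only [C_0, zero_mul, zero_add] using s0)
  have l1 := lin5 h.monic h.deg 0 0 0 _ _ _ (by
    rw [ha 2] at s1
    simp only [mul_zero, add_zero] at s1
    rw [← sub_eq_zero, ← sub_sub, ← sub_sub, ← sub_mul, ← C_sub, sub_eq_add_neg, ← neg_mul, ← C_neg,
      sub_eq_add_neg, ← neg_mul, ← C_neg] at s1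
    simpa only [C_0, zero_mul, zero_add] using s1)
  have l2 := lin5 h.monic h.deg 0 0 _ _ _ _ (by
    rw [ha 3] at s2
    simp only [mul_zero, add_zero] at s2
    rw [← sub_eq_zero, ← sub_sub, ← sub_sub, ← sub_sub, ← sub_mul, ← C_sub, sub_eq_add_neg,
      ← neg_mul, ← C_neg,
      sub_eq_add_neg, ← neg_mul, ← C_neg, sub_eq_add_neg, ← neg_mul, ← C_neg] at s2
    simpa only [C_0, zero_mul, zero_add] using s2)
  have l3 := fun m => lin5 h.monic h.deg m _ _ _ _ _ (by
    have s3 := s3 m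
    rw [ha (m + 4)] at s3
    rw [← sub_eq_zero, ← sub_sub, ← sub_sub, ← sub_sub, ← sub_sub, ← sub_mul, ← C_sub,
      sub_eq_add_neg,
      ← neg_mul, ← C_neg,
      sub_eq_add_neg, ← neg_mul, ← C_neg, sub_eq_add_neg, ← neg_mul, ← C_neg, sub_eq_add_neg,
      ← neg_mul, ← C_neg] at s3
    exact s3)
  clear s0 s1 s2 s3
  obtain ⟨-, -, -, a1, a2⟩ := l0
  obtain ⟨-, -, b1, b2, b3⟩ := l1
  obtain ⟨-, c1, c2, c3, c4⟩ := l2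
  refine ⟨?_, ?_, ?_, ?_, ?_, ?_⟩
  · rintro (_ | _ | _ | n)
    · simp only [zero_add, hk0] at a1 ⊢
      linear_combination a1
    · linear_combination b1
    · linear_combination c1
    · linear_combination (l3 n).1
  · linear_combination -a2
  · rintro (_ | _ | n)
    · simp only [zero_add] at b2 ⊢
      linear_combination -b2
    · linear_combination -c2
    · linear_combination -(l3 n).2.1
  · rintro (_ | _ | n)
    · simp only [zero_add, hk0, hC0] at b3 ⊢
      linear_combination -b3
    · linear_combination -c3
    · linear_combination -(l3 n).2.2.1
  · linear_combination -c4
  · have := (l3 0).2.2.2.2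
    simp only [zero_add] at this
    linear_combination -this

/-- closed form of the constants `k_n`. -/
noncomputable def kk (q : ℂ) (n : ℕ) : ℂ := (q - 1 + q ^ n - q / q ^ n) / (2 * (q - 1))

theorem kk_zero (q : ℂ) : kk q 0 = 0 := by simp [kk]

theorem kk_one {q : ℂ} (hq : q ≠ 0) (h1 : q - 1 ≠ 0) : kk q 1 = 1 := by
  simp only [kk, pow_one]; field_simp; ring

theorem kk_fac {q : ℂ} (hq : q ≠ 0) (h1 : q - 1 ≠ 0) (n : ℕ) :
    kk q n = (q ^ n - 1) * (q ^ n + q) / (2 * (q - 1) * q ^ n) := by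
  simp only [kk]; field_simp; ring

theorem kk_rec {q : ℂ} (hq : q ≠ 0) (h1 : q - 1 ≠ 0) (n : ℕ) :
    kk q (n + 2) = (q + 1 / q) * kk q (n + 1) - kk q n + (1 - (q + 1 / q) / 2) := by
  simp only [kk, pow_succ]; field_simp; ring

theorem kk_inv {q : ℂ} (hq : q ≠ 0) (h1 : q - 1 ≠ 0) (n : ℕ) : kk q⁻¹ n = kk q n := by
  have : 1 - q ≠ 0 := fun h => h1 (by linear_combination -h)
  simp only [kk, inv_pow]; field_simp; ring

theorem kk_gam {q : ℝ} (hq0 : 0 < q) (hq1 : q < 1) (n : ℕ) :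
    gamn q n * alpn q ((n : ℤ) - 1) = kk q n := by
  obtain ⟨u, hu⟩ : ∃ u, u = Real.sqrt q := ⟨_, rfl⟩
  have hu0 : 0 < u := by rw [hu]; exact Real.sqrt_pos.2 hq0
  have hu2 : u ^ 2 = q := by rw [hu]; exact Real.sq_sqrt hq0.le
  have hu1 : u < 1 := by nlinarith
  have hqh : qh q = (u : ℂ) := by rw [qh, hu]
  have hqC : (q : ℂ) = (u : ℂ) ^ 2 := by rw [← hu2]; push_cast; rfl
  have huC : (u : ℂ) ≠ 0 := by exact_mod_cast hu0.ne'
  have hu21 : (u : ℂ) ^ 2 - 1 ≠ 0 := by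
    have : u ^ 2 - 1 ≠ 0 := by nlinarith
    exact_mod_cast this
  rw [gamn, alpn, kk, hqh, hqC, neg_sub, zpow_sub₀ huC, zpow_sub₀ huC, zpow_neg, zpow_natCast,
    zpow_one, ← pow_mul, mul_comm 2 n, pow_mul]
  have hv : (u : ℂ) ^ n ≠ 0 := pow_ne_zero _ huC
  generalize (u : ℂ) ^ n = v at *
  field_simp
  ring

/-- closed form of the coefficients `C_n`. -/
noncomputable def FF (q : ℂ) (n : ℕ) : ℂ := (1 - q ^ n) * (1 + q ^ n / q) / 4

theorem FF_rec {q : ℂ} (hq : q ≠ 0) (h1 : q - 1 ≠ 0) (n : ℕ) :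
    -(FF q (n + 2) + FF q (n + 1)) * kk q (n + 1)
      + (q + 1 / q) * (kk q (n + 2) * FF q (n + 1) + FF q (n + 1) * kk q n)
          - kk q (n + 1) * (FF q (n + 1) + FF q n) - (q - 1 / q) ^ 2 / 4 * kk q (n + 1)
          + (1 - (q + 1 / q) / 2) * FF q (n + 1) = 0 := by
  simp only [kk, FF, pow_succ]
  have := pow_ne_zero n hq
  generalize q ^ n = y at *
  field_simp
  ring

theorem FF_rec3 {q : ℂ} (hq : q ≠ 0) (h1 : q - 1 ≠ 0) (n : ℕ) :
    -FF q (n + 3) * FF q (n + 2) * kk q (n + 1)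
      + (q + 1 / q) * FF q (n + 3) * kk q (n + 2) * FF q (n + 1)
      - kk q (n + 3) * FF q (n + 2) * FF q (n + 1) = 0 := by
  simp only [kk, FF, pow_succ]
  have := pow_ne_zero n hq
  generalize q ^ n = y at *
  field_simp
  ring

theorem FF_unique {q : ℂ} (hq : q ≠ 0) (h1 : q - 1 ≠ 0) (hk : ∀ n, kk q (n + 1) ≠ 0)
    {c : ℕ → ℂ} (c0 : c 0 = 0) (c1 : c 1 = (1 - q) / 2)
    (hc : ∀ n, -(c (n + 2) + c (n + 1)) * kk q (n + 1)
      + (q + 1 / q) * (kk q (n + 2) * c (n + 1) + c (n + 1) * kk q n)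
          - kk q (n + 1) * (c (n + 1) + c n) - (q - 1 / q) ^ 2 / 4 * kk q (n + 1)
          + (1 - (q + 1 / q) / 2) * c (n + 1) = 0) (n : ℕ) : c n = FF q n := by
  induction n using Nat.strong_induction_on with
  | _ n ih =>
    match n with
    | 0 => simp [FF, c0]
    | 1 =>
      rw [c1]; simp only [FF, pow_one]; field_simp; ring
    | n + 2 =>
      have e0 := ih n (by omega)
      have e1 := ih (n + 1) (by omega)
      have h := hc n
      have h' := FF_rec hq h1 n
      rw [e0, e1] at h
      apply mul_right_cancel₀ (hk n)
      linear_combination h' - h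

theorem TProp.inv {q : ℂ} (hq : q ≠ 0) {T : ℂ[X] → ℂ[X]} (hT : TProp q T) : TProp q⁻¹ T := by
  refine ⟨hT.tadd, hT.smul, hT.one, hT.tX, fun f => ?_⟩
  have := hT.star f
  have e1 : q⁻¹ + 1 / q⁻¹ = q + 1 / q := by field_simp; ring
  have e2 : (q⁻¹ - 1 / q⁻¹) ^ 2 = (q - 1 / q) ^ 2 := by field_simp; ring
  rw [e1, e2]
  exact this

theorem appell_suff {q : ℂ} (hq : q ≠ 0) (h1 : q - 1 ≠ 0) {T : ℂ[X] → ℂ[X]} (hT : TProp q T)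
    {P : ℕ → ℂ[X]} {B Co : ℕ → ℂ} (h : MonicOPS P B Co)
    (hB : ∀ n, B n = 0) (hC : ∀ n, 1 ≤ n → Co n = FF q n) :
    T (P 0) = 0 ∧ ∀ n, T (P (n + 1)) = C (kk q (n + 1)) * P n := by
  have ha0 : T (P 0) = 0 := by rw [h.p0, hT.one]
  refine ⟨ha0, ?_⟩
  have r : ∀ n, X * P (n + 1) = P (n + 2) + C 0 * P (n + 1) + C (FF q (n + 1)) * P n := by
    intro n
    rw [h.ttrr n, hC (n + 1) (by omega), hB (n + 1)]; simp
  have r0 : X * P 0 = P 1 := by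
    rw [h.p1, h.p0, hB 0]; simp
  have T0 : T 0 = 0 := by simpa using hT.smul 0 0
  have F0 : FF q 0 = 0 := by simp [FF]
  have k0 := kk_zero q
  intro n
  induction n using Nat.strong_induction_on with
  | _ n ih =>
    match n with
    | 0 =>
      have := kk_one hq h1
      rw [zero_add, this, h.p0, ← r0, h.p0, mul_one, hT.tX]; simp
    | 1 =>
      have s := T_step hT (P 2) (P 1) (P 0) 0 0 0 (kk q 1) 0 0 0 0 0 0 0 (FF q 1) 0 0 0
        (r 0) (by rw [r0]; simp) (by simp) (by simp) (by simp) (by simp) (ih 0 (by omega))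
        (by simp [ha0]) (by simp) (by simp)
      have e1 := kk_rec hq h1 0
      rw [k0] at e1
      rw [← e1] at s
      simpa using s
    | 2 =>
      have s := T_step hT (P 3) (P 2) (P 1) (P 0) 0 0 (kk q 2) (kk q 1) 0 0 0 0 0 0
        (FF q 2) (FF q 1) 0 0
        (r 1) (r 0) (by rw [r0]; simp) (by rw [r0]; simp) (by simp) (by simp) (ih 1 (by omega))
        (ih 0 (by omega)) (by simp [ha0]) (by simp)
      have e1 := kk_rec hq h1 1
      have e2 := congrArg C (FF_rec hq h1 0)
      rw [← e1] at s
      rw [s]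
      simp only [k0, F0, zero_add, C_add, C_sub, C_mul, C_neg, C_pow, C_0] at e2 ⊢
      linear_combination P 0 * e2
    | 3 =>
      have s := T_step hT (P 4) (P 3) (P 2) (P 1) (P 0) 0 (kk q 3) (kk q 2) (kk q 1) 0 0 0 0 0
        (FF q 3) (FF q 2) (FF q 1) 0
        (r 2) (r 1) (by rw [r 0]) (by rw [r 0]) (by rw [r0]; simp) (by rw [r0]; simp)
        (ih 2 (by omega)) (ih 1 (by omega))
        (by rw [ih 0 (by omega)]) (by simp [ha0])
      have e1 := kk_rec hq h1 2
      have e2 := congrArg C (FF_rec hq h1 1)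
      rw [← e1] at s
      rw [s]
      simp only [zero_add, C_add, C_sub, C_mul, C_neg, C_pow, C_0] at e2 ⊢
      linear_combination P 1 * e2
    | m + 4 =>
      have s := T_step hT (P (m + 5)) (P (m + 4)) (P (m + 3)) (P (m + 2)) (P (m + 1)) (P m)
        (kk q (m + 4)) (kk q (m + 3)) (kk q (m + 2)) (kk q (m + 1)) 0 0 0 0
        (FF q (m + 4)) (FF q (m + 3)) (FF q (m + 2)) (FF q (m + 1))
        (r (m + 3)) (r (m + 2)) (by rw [r (m + 1)]) (by rw [r (m + 1)]) (by rw [r m]) (by rw [r m])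
        (ih (m + 3) (by omega)) (ih (m + 2) (by omega)) (by rw [ih (m + 1) (by omega)])
        (by rw [ih m (by omega)])
      have e1 := kk_rec hq h1 (m + 3)
      have e2 := congrArg C (FF_rec hq h1 (m + 2))
      have e3 := congrArg C (FF_rec3 hq h1 m)
      rw [← e1] at s
      rw [s]
      simp only [C_add, C_sub, C_mul, C_neg, C_pow, C_0] at e2 e3 ⊢
      linear_combination P (m + 2) * e2 + P m * e3

theorem appell_k {q : ℂ} (hq : q ≠ 0) (h1 : q - 1 ≠ 0) {T : ℂ[X] → ℂ[X]} (hT : TProp q T)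
    {P : ℕ → ℂ[X]} {B k : ℕ → ℂ} (hk0 : k 0 = 0)
    (hp0 : P 0 = 1) (hp1 : P 1 = X - C (B 0))
    (ha : ∀ n, T (P (n + 1)) = C (k (n + 1)) * P n)
    (hk : ∀ n, k (n + 2) = (q + 1 / q) * k (n + 1) - k n + (1 - (q + 1 / q) / 2)) (n : ℕ) :
    k n = kk q n := by
  have hk1 : k 1 = 1 := by
    have h := ha 0
    have e : P 1 = X + C (-B 0) * 1 := by rw [hp1]; simp; ring
    rw [zero_add, e, hT.tadd, hT.smul, hT.one, hT.tX, hp0] at h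
    simp only [mul_zero, add_zero, mul_one] at h
    rw [← C_1] at h
    exact (C_injective h).symm
  induction n using Nat.strong_induction_on with
  | _ n ih =>
    match n with
    | 0 => rw [hk0, kk_zero]
    | 1 => rw [hk1, kk_one hq h1]
    | n + 2 => rw [hk, kk_rec hq h1, ih n (by omega), ih (n + 1) (by omega)]

theorem appell_nec {q : ℝ} (hq0 : 0 < q) (hq1 : q < 1) {T : ℂ[X] → ℂ[X]} (hT : TProp (q : ℂ) T)
    {P : ℕ → ℂ[X]} {B Co k : ℕ → ℂ} (h : MonicOPS P B Co) (hC0 : Co 0 = 0) (hk0 : k 0 = 0)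
    (ha0 : T (P 0) = 0) (ha : ∀ n, T (P (n + 1)) = C (k (n + 1)) * P n) :
    (∀ n, k n = kk q n) ∧ (∀ n, B n = 0) ∧
      ((∀ n, Co n = FF q n) ∨ (∀ n, Co n = FF (q : ℂ)⁻¹ n)) := by
  obtain ⟨E1, E2, E3, E4, E5, E6⟩ := appell_eqs hT h hC0 hk0 ha0 ha
  have q0 : (q : ℂ) ≠ 0 := by exact_mod_cast hq0.ne'
  have q1 : (q : ℂ) - 1 ≠ 0 := by
    have : q - 1 ≠ 0 := by linarith
    exact_mod_cast this
  have q2 : (q : ℂ) + 1 ≠ 0 := by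
    have : q + 1 ≠ 0 := by positivity
    exact_mod_cast this
  have q3 : (q : ℂ) ^ 2 + 1 ≠ 0 := by
    have : q ^ 2 + 1 ≠ 0 := by positivity
    exact_mod_cast this
  have q4 : (q : ℂ) ^ 2 + q + 1 ≠ 0 := by
    have : q ^ 2 + q + 1 ≠ 0 := by positivity
    exact_mod_cast this
  have hk := appell_k q0 q1 hT hk0 h.p0 h.p1 ha E1
  have hkne : ∀ n, kk (q : ℂ) (n + 1) ≠ 0 := by
    intro n
    rw [kk_fac q0 q1]
    have a1 : (q : ℂ) ^ (n + 1) - 1 ≠ 0 := by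
      have h2 := pow_lt_one₀ hq0.le hq1 (Nat.succ_ne_zero n)
      have : q ^ (n + 1) - 1 ≠ 0 := by
        exact (sub_neg.2 h2).ne
      exact_mod_cast this
    have a2 : (q : ℂ) ^ (n + 1) + q ≠ 0 := by
      have : q ^ (n + 1) + q ≠ 0 := by positivity
      exact_mod_cast this
    exact div_ne_zero (mul_ne_zero a1 a2) (mul_ne_zero (mul_ne_zero two_ne_zero q1)
      (pow_ne_zero _ q0))
  have k1 : k 1 = 1 := by rw [hk, kk_one q0 q1]
  have k2 : k 2 = ((q : ℂ) + 1) ^ 2 / (2 * q) := by rw [hk, kk]; field_simp; ring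
  have k3 : k 3 = ((q : ℂ) ^ 2 + q + 1) * (q ^ 2 + 1) / (2 * q ^ 2) := by
    rw [hk, kk]; field_simp; ring
  have B1 : B 1 = ((q : ℂ) + 1 / q) / 2 * B 0 := by
    rw [k1] at E2; linear_combination -E2
  have B2 : B 2 = ((q : ℂ) ^ 2 + 1 / q ^ 2) / 2 * B 0 := by
    have e := E3 0
    simp only [zero_add, k1] at e
    have : k 2 ≠ 0 := by rw [hk]; exact hkne 1
    apply mul_right_cancel₀ this
    rw [B1] at e
    rw [k2] at e ⊢
    linear_combination (norm := skip) -e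
    field_simp
    ring
  have e4 := E4 0
  have e5 := E4 1
  simp only [zero_add, Nat.reduceAdd, k1, hk0, hC0, B1] at e4
  simp only [Nat.reduceAdd, k1, B1, B2] at e5
  have kne2 : k 2 ≠ 0 := by rw [hk]; exact hkne 1
  have C2 : Co 2 = -(Co 1 + (((q : ℂ) + 1 / q) / 2 * B 0) ^ 2)
      + (q + 1 / q) * (k 2 * Co 1 + ((q : ℂ) + 1 / q) / 2 * B 0 * B 0)
      - (Co 1 + B 0 ^ 2) - (q - 1 / q) ^ 2 / 4 + (1 - (q + 1 / q) / 2) * Co 1 := by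
    linear_combination -e4
  have C3 : Co 3 = -(Co 2 + (((q : ℂ) ^ 2 + 1 / q ^ 2) / 2 * B 0) ^ 2)
      + (q + 1 / q) * ((k 3 * Co 2 + Co 2) / k 2
          + ((q : ℂ) ^ 2 + 1 / q ^ 2) / 2 * B 0 * (((q : ℂ) + 1 / q) / 2 * B 0))
      - (Co 2 + Co 1 + (((q : ℂ) + 1 / q) / 2 * B 0) ^ 2) - (q - 1 / q) ^ 2 / 4
      + (1 - (q + 1 / q) / 2) * Co 2 / k 2 := by
    apply mul_right_cancel₀ kne2
    have := mul_inv_cancel₀ kne2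
    simp only [div_eq_mul_inv _ (k 2)]
    linear_combination -e5 - ((q + 1 / q : ℂ) * (k 3 * Co 2 + Co 2)
      + (1 - (q + 1 / q) / 2) * Co 2) * this
  clear e4 e5
  have hB0 : B 0 = 0 := by
    by_contra hb
    have e : ((q : ℂ) - 1) ^ 2 * (q + 1) ^ 2 * (q ^ 2 + q + 1) / (2 * q ^ 3) * B 0 *
        (Co 1 - (q - 1) ^ 2 / (4 * q) * (B 0 ^ 2 - 1)) = 0 := by
      rw [← E5, B1, B2, C2, k1, k2]
      field_simp
      ring
    have e' : Co 1 = ((q : ℂ) - 1) ^ 2 / (4 * q) * (B 0 ^ 2 - 1) := by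
      rcases mul_eq_zero.1 e with e | e
      · exfalso
        revert e
        simp [q0, q1, q2, q4, hb]
      · linear_combination e
    have f : ((q : ℂ) ^ 2 + q + 1) * (q + 1) ^ 2 * (q ^ 2 + 1) ^ 2 * (q - 1) ^ 2 / (4 * q ^ 5) *
        (((q - 1) * (q + 1)) ^ 2 / (16 * q ^ 2)) * (B 0 ^ 2 - 1) ^ 2 = 0 := by
      rw [← neg_eq_zero, ← E6, C3, C2, k1, k2, k3, e']
      field_simp
      ring
    have f' : B 0 ^ 2 - 1 = 0 := by
      by_contra hne
      revert f
      simp [q0, q1, q2, q3, q4, hne]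
    exact h.Cne 1 le_rfl (by rw [e', f', mul_zero])
  have hB : ∀ n, B n = 0 := by
    intro n
    induction n using Nat.strong_induction_on with
    | _ n ih =>
      match n with
      | 0 => exact hB0
      | 1 => rw [B1, hB0, mul_zero]
      | n + 2 =>
        have e := E3 n
        rw [ih n (by omega), ih (n + 1) (by omega)] at e
        have : k (n + 2) ≠ 0 := by rw [hk]; exact hkne _
        apply mul_right_cancel₀ this
        linear_combination -e
  refine ⟨hk, hB, ?_⟩
  have f : ((q : ℂ) ^ 2 + q + 1) * (q + 1) ^ 2 * (q ^ 2 + 1) ^ 2 * (q - 1) ^ 2 / (4 * q ^ 5) *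
      ((Co 1 - (1 - q) / 2) * (Co 1 - (1 - (q : ℂ)⁻¹) / 2)) = 0 := by
    rw [← E6, C3, C2, k1, k2, k3, hB0]
    field_simp
    ring
  have f' : (Co 1 - (1 - q) / 2) * (Co 1 - (1 - (q : ℂ)⁻¹) / 2) = 0 := by
    by_contra hne
    have hne' := mul_ne_zero_iff.1 hne
    revert f
    rw [imp_false]
    refine mul_ne_zero ?_ hne
    simp [q0, q1, q2, q3, q4]
  have q1' : (q : ℂ)⁻¹ - 1 ≠ 0 := by
    intro hh
    apply q1
    field_simp at hh
    linear_combination -hh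
  have hrec : ∀ n, -(Co (n + 2) + Co (n + 1)) * kk q (n + 1)
      + (q + 1 / q) * (kk q (n + 2) * Co (n + 1) + Co (n + 1) * kk q n)
          - kk q (n + 1) * (Co (n + 1) + Co n) - (q - 1 / q) ^ 2 / 4 * kk q (n + 1)
          + (1 - (q + 1 / q) / 2) * Co (n + 1) = 0 := by
    intro n
    have e := E4 n
    simp only [hB, hk] at e
    linear_combination e
  rcases mul_eq_zero.1 f' with g | g
  · left
    exact FF_unique q0 q1 hkne hC0 (by linear_combination g) hrec
  · right
    refine FF_unique (inv_ne_zero q0) q1' (fun n => by rw [kk_inv q0 q1]; exact hkne n) hC0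
      (by linear_combination g) ?_
    intro n
    have e1 : (q : ℂ)⁻¹ + 1 / (q : ℂ)⁻¹ = q + 1 / q := by field_simp; ring
    have e2 : ((q : ℂ)⁻¹ - 1 / (q : ℂ)⁻¹) ^ 2 = (q - 1 / q) ^ 2 := by field_simp; ring
    simp only [kk_inv q0 q1]
    rw [e1, e2]
    exact hrec n

theorem FF_zpow {q : ℂ} (hq : q ≠ 0) (n : ℕ) :
    (1 - q ^ (1 * n : ℤ)) * (1 + q ^ (1 * ((n : ℤ) - 1))) / 4 = FF q n := by
  rw [FF, one_mul, one_mul, zpow_sub₀ hq, zpow_natCast, zpow_one]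

theorem FF_zpow_inv {q : ℂ} (hq : q ≠ 0) (n : ℕ) :
    (1 - q ^ (-1 * n : ℤ)) * (1 + q ^ (-1 * ((n : ℤ) - 1))) / 4 = FF q⁻¹ n := by
  rw [← FF_zpow (inv_ne_zero hq)]
  simp only [inv_zpow', neg_mul]

/-- a monic OPS satisfies `𝒮_q(𝒟_q P_n) = k_n P_{n-1}` for some constants
`k_n` iff `B_n = 0` for all `n` and `C_n = (1/4)(1 − q^{sn})(1 + q^{s(n−1)})` for some
`s = ±1`; in this case `k_n = γ_n α_{n−1}` for `n ≥ 1` (and `k_0 = 0`), i.e. `(P_n)`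
is the monic Al-Salam–Chihara sequence `Q_n(z; s, −s | q^s)`. -/
theorem stmt_7 (q : ℝ) (hq0 : 0 < q) (hq1 : q < 1)
    (Dq Sq : ℂ[X] → ℂ[X]) (hD : IsAW q Dq) (hS : IsAv q Sq)
    (P : ℕ → ℂ[X]) (B Co : ℕ → ℂ) (hops : MonicOPS P B Co) :
    ((∃ k : ℕ → ℂ, k 0 = 0 ∧ AppellSD Sq Dq P k) ↔
      ((∀ n : ℕ, B n = 0) ∧ ∃ s : ℤ, (s = 1 ∨ s = -1) ∧
        ∀ n : ℕ, 1 ≤ n →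
          Co n = (1 - (q : ℂ) ^ (s * n)) * (1 + (q : ℂ) ^ (s * ((n : ℤ) - 1))) / 4)) ∧
    (∀ k : ℕ → ℂ, AppellSD Sq Dq P k →
      ∀ n : ℕ, 1 ≤ n → k n = gamn q n * alpn q ((n : ℤ) - 1)) := by
  have hT := TProp_of hq0 hq1 hD hS
  have q0 : (q : ℂ) ≠ 0 := by exact_mod_cast hq0.ne'
  have q1 : (q : ℂ) - 1 ≠ 0 := by
    have : q - 1 ≠ 0 := by linarith
    exact_mod_cast this
  have q1' : (q : ℂ)⁻¹ - 1 ≠ 0 := by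
    intro hh
    apply q1
    field_simp at hh
    linear_combination -hh
  have nec : ∀ k : ℕ → ℂ, AppellSD Sq Dq P k → (∀ n, 1 ≤ n → k n = kk q n) ∧ (∀ n, B n = 0) ∧
      ((∀ n, 1 ≤ n → Co n = FF q n) ∨ (∀ n, 1 ≤ n → Co n = FF (q : ℂ)⁻¹ n)) := by
    intro k hA
    have hops' : MonicOPS P B (fun n => if n = 0 then 0 else Co n) := by
      refine ⟨hops.monic, hops.deg, hops.p0, hops.p1, fun n => ?_, fun n hn => ?_⟩
      · simpa using hops.ttrr n
      · have : n ≠ 0 := by omega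
        simpa [this] using hops.Cne n hn
    obtain ⟨a, b, c⟩ := appell_nec hq0 hq1 hT hops' (k := fun n => if n = 0 then 0 else k n)
      (by simp) (by simp) hA.1 (fun n => by simpa using hA.2 n)
    refine ⟨fun n hn => ?_, b, ?_⟩
    · have : n ≠ 0 := by omega
      simpa [this] using a n
    · rcases c with c | c
      · left
        intro n hn
        have : n ≠ 0 := by omega
        simpa [this] using c n
      · right
        intro n hn
        have : n ≠ 0 := by omega
        simpa [this] using c n
  refine ⟨⟨?_, ?_⟩, ?_⟩
  · rintro ⟨k, -, hA⟩
    obtain ⟨-, hB, hC⟩ := nec k hA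
    refine ⟨hB, ?_⟩
    rcases hC with hC | hC
    · exact ⟨1, Or.inl rfl, fun n hn => by rw [hC n hn, ← FF_zpow q0]⟩
    · exact ⟨-1, Or.inr rfl, fun n hn => by rw [hC n hn, ← FF_zpow_inv q0]⟩
  · rintro ⟨hB, s, rfl | rfl, hC⟩
    · exact ⟨kk q, kk_zero _, appell_suff q0 q1 hT hops hB
        (fun n hn => by rw [hC n hn, FF_zpow q0])⟩
    · exact ⟨kk (q : ℂ)⁻¹, kk_zero _, appell_suff (inv_ne_zero q0) q1' (hT.inv q0) hops hB
        (fun n hn => by rw [hC n hn, FF_zpow_inv q0])⟩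
  · intro k hA n hn
    rw [kk_gam hq0 hq1, (nec k hA).1 n hn]
end

section
/- Let u be a regular linear functional on ℂ[z] with monic OPS (P_n)_{n≥0}, and suppose 𝒮_q(𝒟_q P_n) = k_n P_{n−1} for all n ≥ 0, for some constants k_n ∈ ℂ. Then for every n ≥ 0 and every polynomial f ∈ ℂ[z]: ⟨u, P_{n+1}²⟩·⟨u, P_n·(𝒮_q(𝒟_q f))⟩ = k_{n+1}·⟨u, P_n²⟩·⟨u, P_{n+1}·f⟩. (Equivalently, in terms of the dual basis a_n = ⟨u, P_n²⟩^{−1}·P_n·u, one has 𝐃_q(𝐒_q a_n) = −k_{n+1} a_{n+1}.) -/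
open Polynomial

theorem aux_funext (p r : ℂ[X])
    (h : ∀ w : ℂ, w ≠ 0 → w ^ 2 ≠ 1 → p.eval ((w + w⁻¹) / 2) = r.eval ((w + w⁻¹) / 2)) :
    p = r := by
  have hx : (X ^ 2 - 1 : ℂ[X]) ≠ 0 := by
    intro h0
    have := congrArg (Polynomial.eval 0) h0
    simp at this
  apply mul_right_cancel₀ hx
  apply Polynomial.funext
  intro z
  simp only [eval_mul, eval_sub, eval_pow, eval_X, eval_one]
  by_cases hz : z ^ 2 = 1
  · simp [hz]
  obtain ⟨s, hs⟩ := IsAlgClosed.exists_pow_nat_eq (z ^ 2 - 1) (n := 2) (by norm_num)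
  have hw : (z + s) * (z - s) = 1 := by linear_combination -hs
  have hw0 : z + s ≠ 0 := left_ne_zero_of_mul_eq_one hw
  have hinv : (z + s)⁻¹ = z - s := inv_eq_of_mul_eq_one_right hw
  have hzz : ((z + s) + (z + s)⁻¹) / 2 = z := by rw [hinv]; ring
  have hw2 : (z + s) ^ 2 ≠ 1 := by
    intro h2
    have hs0 : (z + s) * (2 * s) = 0 := by linear_combination h2 - hw
    have hs1 : s = 0 := by simpa [hw0] using hs0
    apply hz
    rw [hs1] at h2
    simpa using h2
  have := h (z + s) hw0 hw2
  rw [hzz] at this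
  rw [this]

/-- if the monic OPS of a regular functional `u` satisfies
`𝒮_q(𝒟_q P_n) = k_n P_{n-1}`, then for all `n` and all `f`,
`⟨u,P_{n+1}²⟩·⟨u,P_n·𝒮_q(𝒟_q f)⟩ = k_{n+1}·⟨u,P_n²⟩·⟨u,P_{n+1}·f⟩`
(i.e. `𝐃_q(𝐒_q a_n) = −k_{n+1} a_{n+1}` for the dual basis). -/
theorem stmt_8 (q : ℝ) (hq0 : 0 < q) (hq1 : q < 1)
    (Dq Sq : ℂ[X] → ℂ[X]) (hD : IsAW q Dq) (hS : IsAv q Sq)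
    (u : ℂ[X] →ₗ[ℂ] ℂ) (P : ℕ → ℂ[X])
    (hmonic : ∀ n, (P n).Monic) (hdeg : ∀ n, (P n).natDegree = n)
    (horth : ∀ m n : ℕ, m ≠ n → u (P m * P n) = 0)
    (hreg : ∀ n : ℕ, u (P n ^ 2) ≠ 0)
    (k : ℕ → ℂ) (hAp : AppellSD Sq Dq P k) :
    ∀ n : ℕ, ∀ f : ℂ[X],
      u (P (n + 1) ^ 2) * u (P n * Sq (Dq f)) =
        k (n + 1) * u (P n ^ 2) * u (P (n + 1) * f) := by
  have Dadd : ∀ f g, Dq (f + g) = Dq f + Dq g := by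
    intro f g
    apply aux_funext
    intro w h1 h2
    rw [eval_add, hD _ w h1 h2, hD _ w h1 h2, hD _ w h1 h2, eval_add, eval_add]
    ring
  have Dsmul : ∀ (c : ℂ) f, Dq (c • f) = c • Dq f := by
    intro c f
    apply aux_funext
    intro w h1 h2
    rw [eval_smul, hD _ w h1 h2, hD _ w h1 h2, eval_smul, eval_smul]
    simp only [smul_eq_mul]
    ring
  have Sadd : ∀ f g, Sq (f + g) = Sq f + Sq g := by
    intro f g
    apply aux_funext
    intro w h1 h2
    rw [eval_add, hS _ w h1 h2, hS _ w h1 h2, hS _ w h1 h2, eval_add, eval_add]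
    ring
  have Ssmul : ∀ (c : ℂ) f, Sq (c • f) = c • Sq f := by
    intro c f
    apply aux_funext
    intro w h1 h2
    rw [eval_smul, hS _ w h1 h2, hS _ w h1 h2, eval_smul, eval_smul]
    simp only [smul_eq_mul]
    ring
  intro n f
  let T : Polynomial.Sequence ℂ :=
    { elems' := P
      degree_eq' := fun i => by
        rw [Polynomial.degree_eq_natDegree (hmonic i).ne_zero, hdeg] }
  have hspan : Submodule.span ℂ (Set.range P) = ⊤ :=
    T.span (fun i => by
      have : (T i).leadingCoeff = 1 := hmonic i
      rw [this]; exact isUnit_one)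
  have hf : f ∈ Submodule.span ℂ (Set.range P) := by rw [hspan]; trivial
  induction hf using Submodule.span_induction with
  | mem x hx =>
    obtain ⟨m, rfl⟩ := hx
    cases m with
    | zero =>
      rw [hAp.1, horth (n + 1) 0 (by omega)]
      simp
    | succ j =>
      have e : P n * (Polynomial.C (k (j + 1)) * P j) = k (j + 1) • (P n * P j) := by
        rw [Polynomial.smul_eq_C_mul]; ring
      rw [hAp.2, e, map_smul, smul_eq_mul]
      by_cases hj : n = j
      · subst hj
        rw [← pow_two, ← pow_two]; ring
      · rw [horth n j hj, horth (n + 1) (j + 1) (by omega)]; ring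
  | zero =>
    have h0 : Sq (Dq 0) = 0 := by
      have h1 := Dsmul 0 0
      have h2 := Ssmul 0 0
      simp only [zero_smul] at h1 h2
      rw [h1, h2]
    simp [h0]
  | add x y _ _ hx hy =>
    rw [Dadd, Sadd, mul_add, mul_add, map_add, map_add, mul_add, mul_add, hx, hy]
  | smul a x _ hx =>
    rw [Dsmul, Ssmul, mul_smul_comm, mul_smul_comm, map_smul, map_smul, smul_eq_mul, smul_eq_mul]
    linear_combination a * hx
end
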